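/- arXiv:2111.03526 — 2 statements merged into one kernel-verified Lean document; each statement's English description precedes it below -/
import Mathlib

section
/- Let m > r be positive integers, A ∈ ℤ^{r×m} a positive and abundant integer matrix, b ∈ ℤ^r such that S(A,b) ≠ ∅, and 𝔓 ⊆ 𝔓(A) a set of partitions of [m] such that the partition into singletons belongs to 𝔓 and every 𝔭 ∈ 𝔓 with S_0(A_𝔭,b) ≠ ∅ belongs to 𝔓_0(A) (i.e. A_𝔭 is positive). For each n let p = p(n) ∈ [0,1] and let X_n = |S_𝔓(A,b) ∩ [n]_p^m| be the number of type-𝔓 solutions x to Ax = b with all entries in the random set [n]_p. If n(1−p) → ∞ and n·p^{c(A_𝔭)} → ∞ for every 𝔭 ∈ 𝔓 with S_𝔭(A,b) ≠ ∅, then X̃_n = (X_n − E[X_n])/√(Var X_n) converges in distribution to the standard normal law 𝒩(0,1). -/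
open Matrix Finset MeasureTheory ProbabilityTheory Filter Topology
open scoped BoundedContinuousFunction NNReal ENNReal

attribute [local instance] Classical.propDecidable

noncomputable section

/-- The rank over `ℚ` of an integer matrix. -/
def rkZ {α β : Type*} [Fintype α] [Fintype β] (A : Matrix α β ℤ) : ℕ :=
  (A.map (Int.cast : ℤ → ℚ)).rank

/-- The submatrix consisting of the columns indexed by `Q`. -/
def colSub {α β : Type*} (A : Matrix α β ℤ) (Q : Finset β) : Matrix α Q ℤ :=
  A.submatrix id (fun j => (j : β))

/-- A matrix is positive if `Ax = 0` has a solution with all entries positive and,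
for every pair of distinct indices, a solution whose corresponding entries differ. -/
def IsPositiveMat {α β : Type*} [Fintype β] (A : Matrix α β ℤ) : Prop :=
  (∃ x : β → ℤ, A.mulVec x = 0 ∧ ∀ j, 0 < x j) ∧
    ∀ i j : β, i ≠ j → ∃ x : β → ℤ, A.mulVec x = 0 ∧ x i ≠ x j

/-- A matrix is abundant if it has positive rank and removing at most two columns
does not change the rank. -/
def IsAbundantMat {α β : Type*} [Fintype α] [Fintype β] (A : Matrix α β ℤ) : Prop :=
  0 < rkZ A ∧ ∀ Q : Finset β, Fintype.card β - 2 ≤ Q.card → rkZ (colSub A Q) = rkZ A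

/-- `r_Q(A) = rk(A) - rk(A^{complement of Q})`. -/
def rQ {α β : Type*} [Fintype α] [Fintype β] (A : Matrix α β ℤ) (Q : Finset β) : ℕ :=
  rkZ A - rkZ (colSub A Qᶜ)

/-- The density `c(A) = max over nonempty Q of |Q|/(|Q| - r_Q(A))`. -/
def matDensity {α β : Type*} [Fintype α] [Fintype β] (A : Matrix α β ℤ) : ℝ :=
  sSup {x : ℝ | ∃ Q : Finset β, Q.Nonempty ∧
    x = (Q.card : ℝ) / ((Q.card : ℝ) - (rQ A Q : ℝ))}

/-- The matrix `A_𝔭` obtained by summing columns over the classes of a partition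
(realised as a setoid); columns are indexed by the classes. -/
def contract {α β : Type*} [Fintype β] (A : Matrix α β ℤ) (s : Setoid β) :
    Matrix α (Quotient s) ℤ :=
  fun i c => ∑ j ∈ Finset.univ.filter (fun j => Quotient.mk s j = c), A i j

/-- `𝔓(A)`: partitions whose contracted matrix has full rank `rk(A)`. -/
def partitionFamily {α β : Type*} [Fintype α] [Fintype β] (A : Matrix α β ℤ) :
    Set (Setoid β) :=
  {s | rkZ (contract A s) = rkZ A}

/-- The partition of `β` into singletons, as a setoid. -/
def singletonSetoid (β : Type*) : Setoid β := ⟨Eq, eq_equivalence⟩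

/-- Proper solutions: solutions with pairwise distinct coordinates. -/
def properSols {α β : Type*} [Fintype β] (A : Matrix α β ℤ) (b : α → ℤ) : Set (β → ℤ) :=
  {x | A.mulVec x = b ∧ Function.Injective x}

/-- Type-`𝔓` solutions: solutions whose induced partition (the kernel setoid) lies in `𝔓`. -/
def typeSols {α β : Type*} [Fintype β] (A : Matrix α β ℤ) (b : α → ℤ)
    (P : Set (Setoid β)) : Set (β → ℤ) :=
  {x | A.mulVec x = b ∧ Setoid.ker x ∈ P}

/-- The Bernoulli measure on `Bool` with parameter `p`. -/
def bern (p : ℝ≥0) (h : p ≤ 1) : Measure Bool :=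
  (PMF.bernoulli p (by exact_mod_cast h)).toMeasure

/-- The product Bernoulli measure on `Fin n → Bool`, modelling the random set `[n]_p`. -/
def prodBern (n : ℕ) (p : ℝ≥0) (h : p ≤ 1) : Measure (Fin n → Bool) :=
  Measure.pi fun _ => bern p h

/-- An integer `a` is a selected element of `[n]_p` in outcome `ω`. -/
def selected {n : ℕ} (ω : Fin n → Bool) (a : ℤ) : Prop :=
  ∃ i : Fin n, a = (i : ℕ) + 1 ∧ ω i = true

/-- The number of solutions in `S` whose entries all lie in the random set `[n]_p`. -/
def solCount {β : Type*} (S : Set (β → ℤ)) (n : ℕ) (ω : Fin n → Bool) : ℕ :=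
  Nat.card {x : β → ℤ // x ∈ S ∧ ∀ j, selected ω (x j)}

end

set_option linter.unusedSectionVars false

lemma hasDerivAt_cexpI (c u : ℝ) :
    HasDerivAt (fun v : ℝ => Complex.exp (Complex.I * ((v * c : ℝ) : ℂ)))
      (Complex.I * c * Complex.exp (Complex.I * ((u * c : ℝ) : ℂ))) u := by
  have h1 : HasDerivAt (fun v : ℝ => Complex.I * ((v * c : ℝ) : ℂ)) (Complex.I * c) u := by
    have h0 : HasDerivAt (fun v : ℝ => ((v * c : ℝ) : ℂ)) (c : ℂ) u := by
      have := ((hasDerivAt_id u).mul_const c).ofReal_comp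
      simpa using this
    exact h0.const_mul _
  have := h1.cexp
  rw [mul_comm] at this
  exact this

lemma cexpI_norm (u : ℝ) : ‖Complex.exp (Complex.I * (u : ℂ))‖ = 1 :=
  Complex.norm_exp_I_mul_ofReal u

lemma cexpI_sub_le (u v : ℝ) :
    ‖Complex.exp (Complex.I * (u : ℂ)) - Complex.exp (Complex.I * (v : ℂ))‖ ≤ |u - v| := by
  have : Complex.exp (Complex.I * (u : ℂ)) - Complex.exp (Complex.I * (v : ℂ))
      = Complex.exp (Complex.I * (v : ℂ)) * (Complex.exp (Complex.I * ((u - v : ℝ) : ℂ)) - 1) := by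
    rw [mul_sub, ← Complex.exp_add]
    congr 2
    · push_cast; ring
    · ring
  rw [this, norm_mul, cexpI_norm, one_mul]
  exact Real.norm_exp_I_mul_ofReal_sub_one_le

lemma cexpI_second_order (u : ℝ) :
    ‖Complex.exp (Complex.I * (u : ℂ)) - 1 - Complex.I * u‖ ≤ u ^ 2 := by
  have hd : ∀ v ∈ Set.Icc (-|u|) |u|, HasDerivWithinAt
      (fun v : ℝ => Complex.exp (Complex.I * (v : ℂ)) - 1 - Complex.I * v)
      (Complex.I * Complex.exp (Complex.I * (v : ℂ)) - Complex.I) (Set.Icc (-|u|) |u|) v := by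
    intro v _
    have h1 := hasDerivAt_cexpI 1 v
    have h2 : HasDerivAt (fun v : ℝ => Complex.I * (v : ℂ)) (Complex.I * 1) v :=
      (HasDerivAt.ofReal_comp (hasDerivAt_id v)).const_mul _
    have h3 := ((h1.sub_const 1).fun_sub h2).hasDerivWithinAt (s := Set.Icc (-|u|) |u|)
    simpa using h3
  have hb : ∀ v ∈ Set.Icc (-|u|) |u|,
      ‖Complex.I * Complex.exp (Complex.I * (v : ℂ)) - Complex.I‖ ≤ |u| := by
    intro v hv
    have : Complex.I * Complex.exp (Complex.I * (v : ℂ)) - Complex.I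
      = Complex.I * (Complex.exp (Complex.I * (v : ℂ)) - 1) := by ring
    rw [this, norm_mul, Complex.norm_I, one_mul]
    refine le_trans Real.norm_exp_I_mul_ofReal_sub_one_le ?_
    rw [Real.norm_eq_abs]; exact abs_le.2 hv
  have := Convex.norm_image_sub_le_of_norm_hasDerivWithin_le hd hb (convex_Icc _ _)
    (x := 0) (y := u) (by simp) (by simp [neg_abs_le, le_abs_self])
  simp at this
  exact this.trans (le_of_eq (sq u).symm)

section Tikh
variable {Ω : Type*} [Fintype Ω] [MeasurableSpace Ω] [MeasurableSingletonClass Ω]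
  (μ : Measure Ω) [IsProbabilityMeasure μ]

lemma norm_integral_mul_le {F : Ω → ℝ} {G : Ω → ℂ} {H : Ω → ℝ} (h : ∀ ω, ‖G ω‖ ≤ H ω) :
    ‖∫ ω, (F ω : ℂ) * G ω ∂μ‖ ≤ ∫ ω, |F ω| * H ω ∂μ := by
  refine (norm_integral_le_integral_norm _).trans ?_
  refine integral_mono Integrable.of_finite Integrable.of_finite ?_
  intro ω
  simp only [norm_mul, Complex.norm_real, Real.norm_eq_abs]
  exact mul_le_mul_of_nonneg_left (h ω) (abs_nonneg _)

lemma norm_integral_le' {G : Ω → ℂ} {H : Ω → ℝ} (h : ∀ ω, ‖G ω‖ ≤ H ω) :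
    ‖∫ ω, G ω ∂μ‖ ≤ ∫ ω, H ω ∂μ := by
  refine (norm_integral_le_integral_norm _).trans ?_
  exact integral_mono Integrable.of_finite Integrable.of_finite h

variable {V : Type*} [Fintype V] (r : V → V → Prop) (ξ : V → Ω → ℝ)

/-- The third-order dependence sum. -/
noncomputable def depSum : ℝ :=
  ∑ x, ∑ y ∈ univ.filter (fun y => r x y), ∑ z ∈ univ.filter (fun z => r x z ∨ r y z),
    ((∫ ω, |ξ x ω * ξ y ω| * |ξ z ω| ∂μ) + (∫ ω, |ξ x ω * ξ y ω| ∂μ) * ∫ ω, |ξ z ω| ∂μ)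

lemma tikh_err1 (t : ℝ) (x : V)
    (h1 : ∫ ω, (ξ x ω : ℂ) * Complex.exp (Complex.I *
      ((t * ∑ z ∈ univ.filter (fun z => ¬ r x z), ξ z ω : ℝ) : ℂ)) ∂μ = 0) :
    ‖(∫ ω, (ξ x ω : ℂ) * Complex.exp (Complex.I * ((t * ∑ z, ξ z ω : ℝ) : ℂ)) ∂μ)
      - Complex.I * t * ∑ y ∈ univ.filter (fun y => r x y),
        ∫ ω, ((ξ x ω * ξ y ω : ℝ) : ℂ) *
          Complex.exp (Complex.I * ((t * ∑ z, ξ z ω : ℝ) : ℂ)) ∂μ‖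
    ≤ t ^ 2 * ∑ y ∈ univ.filter (fun y => r x y), ∑ z ∈ univ.filter (fun z => r x z),
        ∫ ω, |ξ x ω * ξ y ω| * |ξ z ω| ∂μ := by
  set e : Ω → ℂ := fun ω => Complex.exp (Complex.I * ((t * ∑ z, ξ z ω : ℝ) : ℂ)) with he
  set η : Ω → ℝ := fun ω => ∑ y ∈ univ.filter (fun y => r x y), ξ y ω with hη
  have hsum : ∀ ω, ∑ z, ξ z ω = η ω + ∑ z ∈ univ.filter (fun z => ¬ r x z), ξ z ω := by
    intro ω; rw [hη]; exact (Finset.sum_filter_add_sum_filter_not _ _ _).symm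
  have e1 : (∫ ω, (ξ x ω : ℂ) * e ω ∂μ)
      - Complex.I * t * ∑ y ∈ univ.filter (fun y => r x y),
        ∫ ω, ((ξ x ω * ξ y ω : ℝ) : ℂ) * e ω ∂μ
      = ∫ ω, (ξ x ω : ℂ) * (- e ω * (Complex.exp (Complex.I * ((- (t * η ω) : ℝ) : ℂ)) - 1
          - Complex.I * ((- (t * η ω) : ℝ) : ℂ))) ∂μ := by
    rw [← integral_finsetSum _ (fun _ _ => Integrable.of_finite), ← integral_const_mul]
    rw [← sub_zero (∫ ω, (ξ x ω : ℂ) * e ω ∂μ), ← h1,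
      ← integral_sub Integrable.of_finite Integrable.of_finite,
      ← integral_sub Integrable.of_finite Integrable.of_finite]
    congr 1
    ext ω
    have hexp : Complex.exp (Complex.I * ((t * ∑ z ∈ univ.filter (fun z => ¬ r x z), ξ z ω : ℝ) : ℂ))
       = e ω * Complex.exp (Complex.I * ((- (t * η ω) : ℝ) : ℂ)) := by
      rw [he]; simp only [← Complex.exp_add]
      congr 1
      rw [hsum ω]; push_cast; ring
    have hs2 : ∑ y ∈ univ.filter (fun y => r x y), ((ξ x ω * ξ y ω : ℝ) : ℂ) * e ω
        = (ξ x ω : ℂ) * (η ω : ℂ) * e ω := by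
      rw [← Finset.sum_mul]
      congr 1
      rw [hη]; push_cast; rw [Finset.mul_sum]
    rw [hexp, hs2]
    push_cast; ring
  rw [e1]
  refine (norm_integral_mul_le μ (H := fun ω => t ^ 2 * η ω ^ 2) ?_).trans ?_
  · intro ω
    rw [norm_mul, norm_neg, cexpI_norm, one_mul]
    refine (cexpI_second_order _).trans (le_of_eq (by ring))
  · simp_rw [← integral_finsetSum _ (fun _ _ => Integrable.of_finite (μ := μ))]
    rw [← integral_const_mul]
    refine integral_mono Integrable.of_finite Integrable.of_finite ?_
    intro ω
    have : η ω ^ 2 ≤ (∑ y ∈ univ.filter (fun y => r x y), |ξ y ω|) ^ 2 :=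
      sq_le_sq.2 ((Finset.abs_sum_le_sum_abs _ _).trans (le_abs_self _))
    have h2 : ∑ y ∈ univ.filter (fun y => r x y), ∑ z ∈ univ.filter (fun z => r x z),
         |ξ x ω * ξ y ω| * |ξ z ω| = |ξ x ω| * (∑ y ∈ univ.filter (fun y => r x y), |ξ y ω|) ^ 2 := by
      rw [sq, Finset.sum_mul_sum, Finset.mul_sum]
      refine Finset.sum_congr rfl fun y _ => ?_
      rw [Finset.mul_sum]
      refine Finset.sum_congr rfl fun z _ => ?_
      rw [abs_mul]; ring
    simp only
    rw [h2]
    have := mul_le_mul_of_nonneg_left this (mul_nonneg (abs_nonneg (ξ x ω)) (sq_nonneg t))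
    linarith

lemma tikh_err2 (t : ℝ) (x y : V)
    (h2 : ∫ ω, ((ξ x ω * ξ y ω : ℝ) : ℂ) * Complex.exp (Complex.I *
      ((t * ∑ z ∈ univ.filter (fun z => ¬ (r x z ∨ r y z)), ξ z ω : ℝ) : ℂ)) ∂μ
      = ((∫ ω, ξ x ω * ξ y ω ∂μ : ℝ) : ℂ) * ∫ ω, Complex.exp (Complex.I *
      ((t * ∑ z ∈ univ.filter (fun z => ¬ (r x z ∨ r y z)), ξ z ω : ℝ) : ℂ)) ∂μ) :
    ‖(∫ ω, ((ξ x ω * ξ y ω : ℝ) : ℂ) * Complex.exp (Complex.I * ((t * ∑ z, ξ z ω : ℝ) : ℂ)) ∂μ)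
      - ((∫ ω, ξ x ω * ξ y ω ∂μ : ℝ) : ℂ) *
        ∫ ω, Complex.exp (Complex.I * ((t * ∑ z, ξ z ω : ℝ) : ℂ)) ∂μ‖
    ≤ |t| * ∑ z ∈ univ.filter (fun z => r x z ∨ r y z),
      ((∫ ω, |ξ x ω * ξ y ω| * |ξ z ω| ∂μ) + (∫ ω, |ξ x ω * ξ y ω| ∂μ) * ∫ ω, |ξ z ω| ∂μ) := by
  set e : Ω → ℂ := fun ω => Complex.exp (Complex.I * ((t * ∑ z, ξ z ω : ℝ) : ℂ)) with he
  set e' : Ω → ℂ := fun ω => Complex.exp (Complex.I *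
      ((t * ∑ z ∈ univ.filter (fun z => ¬ (r x z ∨ r y z)), ξ z ω : ℝ) : ℂ)) with he'
  have hdiff : ∀ ω, ‖e ω - e' ω‖ ≤ |t| * ∑ z ∈ univ.filter (fun z => r x z ∨ r y z), |ξ z ω| := by
    intro ω
    refine (cexpI_sub_le _ _).trans ?_
    rw [← mul_sub, abs_mul]
    refine mul_le_mul_of_nonneg_left ?_ (abs_nonneg _)
    rw [← Finset.sum_filter_add_sum_filter_not univ (fun z => r x z ∨ r y z) (fun z => ξ z ω),
      add_sub_cancel_right]
    exact Finset.abs_sum_le_sum_abs _ _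
  have key : (∫ ω, ((ξ x ω * ξ y ω : ℝ) : ℂ) * e ω ∂μ)
      - ((∫ ω, ξ x ω * ξ y ω ∂μ : ℝ) : ℂ) * ∫ ω, e ω ∂μ
      = (∫ ω, ((ξ x ω * ξ y ω : ℝ) : ℂ) * (e ω - e' ω) ∂μ)
        - ((∫ ω, ξ x ω * ξ y ω ∂μ : ℝ) : ℂ) * ∫ ω, (e ω - e' ω) ∂μ := by
    rw [integral_sub Integrable.of_finite Integrable.of_finite]
    simp_rw [mul_sub]
    rw [integral_sub Integrable.of_finite Integrable.of_finite, h2]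
    ring
  rw [key]
  refine (norm_sub_le _ _).trans ?_
  have b1 := norm_integral_mul_le μ (F := fun ω => ξ x ω * ξ y ω) hdiff
  have b2 := norm_integral_le' μ hdiff
  have b3 : |∫ ω, ξ x ω * ξ y ω ∂μ| ≤ ∫ ω, |ξ x ω * ξ y ω| ∂μ := abs_integral_le_integral_abs
  have c1 : ∫ ω, |ξ x ω * ξ y ω| * (|t| * ∑ z ∈ univ.filter (fun z => r x z ∨ r y z), |ξ z ω|) ∂μ
      = |t| * ∑ z ∈ univ.filter (fun z => r x z ∨ r y z), ∫ ω, |ξ x ω * ξ y ω| * |ξ z ω| ∂μ := by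
    rw [← integral_finsetSum _ (fun _ _ => Integrable.of_finite), ← integral_const_mul]
    congr 1; ext ω
    rw [← Finset.mul_sum]; ring
  have c2 : ∫ ω, (|t| * ∑ z ∈ univ.filter (fun z => r x z ∨ r y z), |ξ z ω|) ∂μ
      = |t| * ∑ z ∈ univ.filter (fun z => r x z ∨ r y z), ∫ ω, |ξ z ω| ∂μ := by
    rw [← integral_finsetSum _ (fun _ _ => Integrable.of_finite), ← integral_const_mul]
  rw [c1] at b1
  rw [c2] at b2
  rw [norm_mul, Complex.norm_real, Real.norm_eq_abs, Finset.sum_add_distrib, mul_add]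
  refine add_le_add b1 ?_
  refine (mul_le_mul b3 b2 (norm_nonneg _) (integral_nonneg fun _ => abs_nonneg _)).trans ?_
  rw [← Finset.mul_sum]
  apply le_of_eq; ring

theorem tikh
    (h1 : ∀ t : ℝ, ∀ x, ∫ ω, (ξ x ω : ℂ) * Complex.exp (Complex.I *
      ((t * ∑ z ∈ univ.filter (fun z => ¬ r x z), ξ z ω : ℝ) : ℂ)) ∂μ = 0)
    (h2 : ∀ t : ℝ, ∀ x y, ∫ ω, ((ξ x ω * ξ y ω : ℝ) : ℂ) * Complex.exp (Complex.I *
      ((t * ∑ z ∈ univ.filter (fun z => ¬ (r x z ∨ r y z)), ξ z ω : ℝ) : ℂ)) ∂μ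
      = ((∫ ω, ξ x ω * ξ y ω ∂μ : ℝ) : ℂ) * ∫ ω, Complex.exp (Complex.I *
      ((t * ∑ z ∈ univ.filter (fun z => ¬ (r x z ∨ r y z)), ξ z ω : ℝ) : ℂ)) ∂μ)
    (hvar : ∑ x, ∑ y ∈ univ.filter (fun y => r x y), ∫ ω, ξ x ω * ξ y ω ∂μ = 1) (t : ℝ) :
    ‖(∫ ω, Complex.exp (Complex.I * ((t * ∑ z, ξ z ω : ℝ) : ℂ)) ∂μ)
      - Complex.exp (-(t : ℂ) ^ 2 / 2)‖ ≤ 2 * depSum μ r ξ * |t| ^ 3 := by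
  set φ : ℝ → ℂ := fun t => ∫ ω, Complex.exp (Complex.I * ((t * ∑ z, ξ z ω : ℝ) : ℂ)) ∂μ with hφ
  set D := depSum μ r ξ with hD
  set φ' : ℝ → ℂ := fun t => ∑ x, Complex.I *
    ∫ ω, (ξ x ω : ℂ) * Complex.exp (Complex.I * ((t * ∑ z, ξ z ω : ℝ) : ℂ)) ∂μ with hφ'
  have hder : ∀ t, HasDerivAt φ (φ' t) t := by
    intro t
    have e1 : φ = fun t => ∑ ω, μ.real {ω} • Complex.exp (Complex.I * ((t * ∑ z, ξ z ω : ℝ) : ℂ)) := by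
      ext t; rw [hφ]; simp only; rw [integral_fintype Integrable.of_finite]
    have e2 : φ' t = ∑ ω, μ.real {ω} • (Complex.I * ((∑ z, ξ z ω : ℝ) : ℂ) *
        Complex.exp (Complex.I * ((t * ∑ z, ξ z ω : ℝ) : ℂ))) := by
      rw [hφ']; simp only
      rw [← Finset.mul_sum, ← integral_finsetSum _ (fun _ _ => Integrable.of_finite),
        integral_fintype Integrable.of_finite, Finset.mul_sum]
      refine Finset.sum_congr rfl fun ω _ => ?_
      rw [← Finset.sum_mul]
      push_cast
      rw [Complex.real_smul, Complex.real_smul]; ring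
    rw [e1, e2]
    refine HasDerivAt.fun_sum fun ω _ => ?_
    exact (hasDerivAt_cexpI _ t).const_smul (μ.real {ω})
  have herr : ∀ t, ‖φ' t + t * φ t‖ ≤ 2 * D * t ^ 2 := by
    intro t
    set E : V → ℂ := fun x => (∫ ω, (ξ x ω : ℂ) *
        Complex.exp (Complex.I * ((t * ∑ z, ξ z ω : ℝ) : ℂ)) ∂μ)
      - Complex.I * t * ∑ y ∈ univ.filter (fun y => r x y),
        ∫ ω, ((ξ x ω * ξ y ω : ℝ) : ℂ) *
          Complex.exp (Complex.I * ((t * ∑ z, ξ z ω : ℝ) : ℂ)) ∂μ with hE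
    set G : V → V → ℂ := fun x y => (∫ ω, ((ξ x ω * ξ y ω : ℝ) : ℂ) *
        Complex.exp (Complex.I * ((t * ∑ z, ξ z ω : ℝ) : ℂ)) ∂μ)
      - ((∫ ω, ξ x ω * ξ y ω ∂μ : ℝ) : ℂ) *
        ∫ ω, Complex.exp (Complex.I * ((t * ∑ z, ξ z ω : ℝ) : ℂ)) ∂μ with hG
    have e0 : φ' t + t * φ t = Complex.I * ∑ x, E x
        - t * ∑ x, ∑ y ∈ univ.filter (fun y => r x y), G x y := by
      have : (∑ x, ∑ y ∈ univ.filter (fun y => r x y), ((∫ ω, ξ x ω * ξ y ω ∂μ : ℝ) : ℂ)) = 1 := by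
        exact_mod_cast hvar
      have a1 : ∑ x, ∑ y ∈ univ.filter (fun y => r x y), G x y
         = (∑ x, ∑ y ∈ univ.filter (fun y => r x y), (∫ ω, ((ξ x ω * ξ y ω : ℝ) : ℂ) *
        Complex.exp (Complex.I * ((t * ∑ z, ξ z ω : ℝ) : ℂ)) ∂μ)) - φ t := by
        rw [hG]; simp only [Finset.sum_sub_distrib, ← Finset.sum_mul]
        rw [this, one_mul]
      have a2 : ∑ x, E x = (∑ x, ∫ ω, (ξ x ω : ℂ) *
        Complex.exp (Complex.I * ((t * ∑ z, ξ z ω : ℝ) : ℂ)) ∂μ) - Complex.I * t *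
          (∑ x, ∑ y ∈ univ.filter (fun y => r x y), (∫ ω, ((ξ x ω * ξ y ω : ℝ) : ℂ) *
        Complex.exp (Complex.I * ((t * ∑ z, ξ z ω : ℝ) : ℂ)) ∂μ)) := by
        rw [hE]; simp only [Finset.sum_sub_distrib, Finset.mul_sum]
      rw [a1, a2, hφ']
      simp only [← Finset.mul_sum]
      have hI := Complex.I_mul_I
      linear_combination (-(t : ℂ) * (∑ x, ∑ y ∈ univ.filter (fun y => r x y), (∫ ω, ((ξ x ω * ξ y ω : ℝ) : ℂ) *
        Complex.exp (Complex.I * ((t * ∑ z, ξ z ω : ℝ) : ℂ)) ∂μ))) * -hI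
    rw [e0]
    have hnn : ∀ x y z, 0 ≤ ∫ ω, |ξ x ω * ξ y ω| * |ξ z ω| ∂μ := fun x y z =>
      integral_nonneg fun _ => by positivity
    have hnn2 : ∀ x y z, 0 ≤ (∫ ω, |ξ x ω * ξ y ω| ∂μ) * ∫ ω, |ξ z ω| ∂μ := fun x y z =>
      mul_nonneg (integral_nonneg fun _ => by positivity) (integral_nonneg fun _ => by positivity)
    have b1 : ‖∑ x, E x‖ ≤ t ^ 2 * D := by
      refine (norm_sum_le _ _).trans ?_
      rw [hD, depSum, Finset.mul_sum]
      refine Finset.sum_le_sum fun x _ => ?_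
      refine (tikh_err1 μ r ξ t x (h1 t x)).trans ?_
      refine mul_le_mul_of_nonneg_left ?_ (sq_nonneg _)
      refine Finset.sum_le_sum fun y _ => ?_
      refine (Finset.sum_le_sum_of_subset_of_nonneg (t := univ.filter (fun z => r x z ∨ r y z))
        ?_ fun z _ _ => hnn x y z).trans ?_
      · intro z; simp only [Finset.mem_filter, Finset.mem_univ, true_and]; exact Or.inl
      · exact Finset.sum_le_sum fun z _ => le_add_of_nonneg_right (hnn2 x y z)
    have b2 : ‖∑ x, ∑ y ∈ univ.filter (fun y => r x y), G x y‖ ≤ |t| * D := by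
      refine (norm_sum_le _ _).trans ?_
      rw [hD, depSum, Finset.mul_sum]
      refine Finset.sum_le_sum fun x _ => ?_
      refine (norm_sum_le _ _).trans ?_
      rw [Finset.mul_sum]
      refine Finset.sum_le_sum fun y _ => ?_
      exact tikh_err2 μ r ξ t x y (h2 t x y)
    refine (norm_sub_le _ _).trans ?_
    rw [norm_mul, norm_mul, Complex.norm_I, one_mul, Complex.norm_real, Real.norm_eq_abs]
    have := mul_le_mul_of_nonneg_left b2 (abs_nonneg t)
    have e3 : |t| * (|t| * D) = t ^ 2 * D := by rw [← mul_assoc, ← sq, sq_abs]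
    linarith
  have hD0 : 0 ≤ D := by
    rw [hD, depSum]
    refine Finset.sum_nonneg fun x _ => Finset.sum_nonneg fun y _ => Finset.sum_nonneg fun z _ => ?_
    exact add_nonneg (integral_nonneg fun _ => by positivity)
      (mul_nonneg (integral_nonneg fun _ => by positivity) (integral_nonneg fun _ => by positivity))
  -- multiply by the Gaussian factor
  have hg : ∀ s : ℝ, HasDerivAt (fun s : ℝ => Complex.exp (((s ^ 2 / 2 : ℝ)) : ℂ))
      ((s : ℂ) * Complex.exp (((s ^ 2 / 2 : ℝ)) : ℂ)) s := by
    intro s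
    have h0 : HasDerivAt (fun s : ℝ => ((s ^ 2 / 2 : ℝ) : ℂ)) ((s : ℝ) : ℂ) s := by
      have h00 : HasDerivAt (fun s : ℝ => s ^ 2 / 2) s s := by
        have := ((hasDerivAt_id s).pow 2).div_const 2
        simpa using this
      exact h00.ofReal_comp
    have := h0.cexp
    rw [mul_comm] at this
    exact this
  have hψ : ∀ s ∈ Set.Icc (-|t|) |t|, HasDerivWithinAt
      (fun s : ℝ => φ s * Complex.exp (((s ^ 2 / 2 : ℝ)) : ℂ))
      ((φ' s + s * φ s) * Complex.exp (((s ^ 2 / 2 : ℝ)) : ℂ)) (Set.Icc (-|t|) |t|) s := by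
    intro s _
    have := ((hder s).fun_mul (hg s)).hasDerivWithinAt (s := Set.Icc (-|t|) |t|)
    exact this.congr_deriv (by ring)
  have hbd : ∀ s ∈ Set.Icc (-|t|) |t|,
      ‖(φ' s + s * φ s) * Complex.exp (((s ^ 2 / 2 : ℝ)) : ℂ)‖
        ≤ 2 * D * t ^ 2 * Real.exp (t ^ 2 / 2) := by
    intro s hs
    have hst : s ^ 2 ≤ t ^ 2 := sq_le_sq.2 (abs_le.2 hs)
    rw [norm_mul, Complex.norm_exp_ofReal]
    refine mul_le_mul ((herr s).trans ?_) (Real.exp_le_exp.2 (by linarith)) (Real.exp_pos _).le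
      (by positivity)
    exact mul_le_mul_of_nonneg_left hst (by positivity)
  have hfin := Convex.norm_image_sub_le_of_norm_hasDerivWithin_le hψ hbd (convex_Icc _ _)
    (x := 0) (y := t) (by simp) (by simp [neg_abs_le, le_abs_self])
  have hφ0 : φ 0 = 1 := by rw [hφ]; simp
  simp only [hφ0] at hfin
  have efin : φ t - Complex.exp (-(t : ℂ) ^ 2 / 2)
      = (φ t * Complex.exp (((t ^ 2 / 2 : ℝ)) : ℂ) - 1 * Complex.exp ((((0 : ℝ) ^ 2 / 2 : ℝ)) : ℂ))
        * Complex.exp (((-(t ^ 2 / 2) : ℝ)) : ℂ) := by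
    rw [sub_mul, mul_assoc, ← Complex.exp_add]
    push_cast
    simp
    rw [neg_div]
  change ‖φ t - _‖ ≤ _
  rw [efin, norm_mul, Complex.norm_exp_ofReal]
  refine (mul_le_mul_of_nonneg_right hfin (Real.exp_pos _).le).trans (le_of_eq ?_)
  rw [Real.exp_neg, sub_zero, Real.norm_eq_abs]
  have := (Real.exp_pos (t ^ 2 / 2)).ne'
  field_simp
  rw [← sq_abs t]; ring

end Tikh

instance bern_isProb (p : ℝ≥0) (h : p ≤ 1) : IsProbabilityMeasure (bern p h) := by
  unfold bern; infer_instance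

instance prodBern_isProb (n : ℕ) (p : ℝ≥0) (h : p ≤ 1) :
    IsProbabilityMeasure (prodBern n p h) := by
  unfold prodBern; infer_instance

/-- Indicator that all elements of `S` are selected. -/
noncomputable def ind {n : ℕ} (S : Finset (Fin n)) (ω : Fin n → Bool) : ℝ :=
  ∏ a ∈ S, if ω a = true then 1 else 0

lemma ind_eq {n : ℕ} (S : Finset (Fin n)) (ω : Fin n → Bool) :
    ind S ω = if ∀ a ∈ S, ω a = true then 1 else 0 := by
  unfold ind
  split_ifs with h
  · exact Finset.prod_eq_one fun a ha => by simp [h a ha]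
  · push Not at h
    obtain ⟨a, ha, h⟩ := h
    exact Finset.prod_eq_zero ha (by simp [h])

lemma ind_nonneg {n : ℕ} (S : Finset (Fin n)) (ω : Fin n → Bool) : 0 ≤ ind S ω := by
  rw [ind_eq]; split_ifs <;> norm_num

lemma ind_le_one {n : ℕ} (S : Finset (Fin n)) (ω : Fin n → Bool) : ind S ω ≤ 1 := by
  rw [ind_eq]; split_ifs <;> norm_num

lemma ind_mul {n : ℕ} (S T : Finset (Fin n)) (ω : Fin n → Bool) :
    ind S ω * ind T ω = ind (S ∪ T) ω := by
  simp only [ind_eq, Finset.mem_union, or_imp, forall_and]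
  split_ifs <;> simp_all

lemma bern_integral (p : ℝ≥0) (h : p ≤ 1) :
    ∫ x, (if x = true then (1 : ℝ) else 0) ∂ bern p h = p := by
  unfold bern
  rw [PMF.integral_eq_sum]
  simp [PMF.bernoulli_apply]

section
variable {n : ℕ} {p : ℝ≥0} {hp : p ≤ 1}

lemma integral_ind (S : Finset (Fin n)) :
    ∫ ω, ind S ω ∂ prodBern n p hp = (p : ℝ) ^ S.card := by
  have : ∀ ω : Fin n → Bool, ind S ω =
      ∏ a, (fun (a : Fin n) (x : Bool) => if a ∈ S then (if x = true then (1 : ℝ) else 0) else 1)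
        a (ω a) := by
    intro ω
    unfold ind
    simp only
    rw [Finset.prod_ite_mem, Finset.univ_inter]
  rw [integral_congr_ae (Eventually.of_forall this)]
  unfold prodBern
  refine (integral_fintype_prod_eq_prod (𝕜 := ℝ) (μ := fun _ : Fin n => bern p hp)
    (fun (a : Fin n) (x : Bool) => if a ∈ S then (if x = true then (1 : ℝ) else 0) else 1)).trans ?_
  have h2 : ∀ a : Fin n, ∫ x, (if a ∈ S then (if x = true then (1 : ℝ) else 0) else 1) ∂ bern p hp
      = if a ∈ S then (p : ℝ) else 1 := by
    intro a
    split_ifs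
    · exact bern_integral p hp
    · rw [integral_const, probReal_univ, one_smul]
  simp_rw [h2]
  rw [Finset.prod_ite_mem, Finset.univ_inter, Finset.prod_const]

lemma integral_mul_of_disjoint {F G : (Fin n → Bool) → ℂ} {S T : Finset (Fin n)}
    (hST : Disjoint S T) (hF : DependsOn F (S : Set (Fin n))) (hG : DependsOn G (T : Set (Fin n))) :
    ∫ ω, F ω * G ω ∂ prodBern n p hp
      = (∫ ω, F ω ∂ prodBern n p hp) * ∫ ω, G ω ∂ prodBern n p hp := by
  obtain ⟨F', hF'⟩ := dependsOn_iff_exists_comp.1 hF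
  obtain ⟨G', hG'⟩ := dependsOn_iff_exists_comp.1 hG
  have hi : iIndepFun (fun (i : Fin n) (ω : Fin n → Bool) => ω i) (prodBern n p hp) := by
    unfold prodBern
    exact iIndepFun_pi (X := fun _ x => x) (fun _ => measurable_id.aemeasurable)
  have hfi := hi.indepFun_finset S T hST (fun i => measurable_pi_apply i)
  have hFG : IndepFun F G (prodBern n p hp) := by
    have := hfi.comp (φ := F') (ψ := G') (measurable_of_finite _) (measurable_of_finite _)
    rw [hF', hG']
    exact this
  exact hFG.integral_fun_mul_eq_mul_integral (measurable_of_finite _).aestronglyMeasurable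
    (measurable_of_finite _).aestronglyMeasurable

/-- The centred indicator. -/
noncomputable def cind (p : ℝ≥0) (S : Finset (Fin n)) (ω : Fin n → Bool) : ℝ :=
  ind S ω - (p : ℝ) ^ S.card

lemma ind_dependsOn (S : Finset (Fin n)) {ω ω' : Fin n → Bool} (h : ∀ i ∈ S, ω i = ω' i) :
    ind S ω = ind S ω' := by
  unfold ind
  exact Finset.prod_congr rfl fun a ha => by rw [h a ha]

lemma cind_dependsOn (S : Finset (Fin n)) {ω ω' : Fin n → Bool} (h : ∀ i ∈ S, ω i = ω' i) :
    cind p S ω = cind p S ω' := by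
  unfold cind; rw [ind_dependsOn S h]

lemma integral_cind (S : Finset (Fin n)) : ∫ ω, cind p S ω ∂ prodBern n p hp = 0 := by
  unfold cind
  rw [integral_sub Integrable.of_finite Integrable.of_finite, integral_ind]
  simp

lemma integral_cind_mul (S T : Finset (Fin n)) :
    ∫ ω, cind p S ω * cind p T ω ∂ prodBern n p hp
      = (p : ℝ) ^ (S ∪ T).card - (p : ℝ) ^ (S.card + T.card) := by
  have : ∀ ω, cind p S ω * cind p T ω = ind (S ∪ T) ω - (p : ℝ) ^ T.card * ind S ω
      - (p : ℝ) ^ S.card * ind T ω + (p : ℝ) ^ (S.card + T.card) := by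
    intro ω; unfold cind; rw [← ind_mul, pow_add]; ring
  simp_rw [this]
  rw [integral_add Integrable.of_finite Integrable.of_finite,
    integral_sub Integrable.of_finite Integrable.of_finite,
    integral_sub Integrable.of_finite Integrable.of_finite,
    integral_const_mul, integral_const_mul, integral_ind, integral_ind, integral_ind]
  simp
  ring

lemma abs_cind_le (S : Finset (Fin n)) (ω : Fin n → Bool) :
    |cind p S ω| ≤ ind S ω + (p : ℝ) ^ S.card := by
  unfold cind
  have h1 := ind_nonneg S ω
  have h2 : (0 : ℝ) ≤ (p : ℝ) ^ S.card := by positivity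
  rw [abs_le]; constructor <;> linarith

lemma abs_cind_le_one (hp : p ≤ 1) (S : Finset (Fin n)) (ω : Fin n → Bool) :
    |cind p S ω| ≤ 1 := by
  unfold cind
  have h1 := ind_nonneg S ω
  have h1' := ind_le_one S ω
  have h2 : (0 : ℝ) ≤ (p : ℝ) ^ S.card := by positivity
  have h3 : (p : ℝ) ^ S.card ≤ 1 := pow_le_one₀ (by positivity) (by exact_mod_cast hp)
  rw [abs_le]; constructor <;> linarith

lemma integral_abs_cind_le (S : Finset (Fin n)) :
    ∫ ω, |cind p S ω| ∂ prodBern n p hp ≤ 2 * S.card * (1 - p) := by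
  have hp' : (p : ℝ) ≤ 1 := by exact_mod_cast hp
  have : ∀ ω, |cind p S ω| ≤ (1 - ind S ω) + (1 - (p : ℝ) ^ S.card) := by
    intro ω
    unfold cind
    have h1' := ind_le_one S ω
    have h3 : (p : ℝ) ^ S.card ≤ 1 := pow_le_one₀ (by positivity) hp'
    rw [abs_le]; constructor <;> linarith
  refine (integral_mono Integrable.of_finite Integrable.of_finite this).trans ?_
  rw [integral_add Integrable.of_finite Integrable.of_finite,
    integral_sub Integrable.of_finite Integrable.of_finite, integral_ind]
  simp
  have hb := one_add_mul_le_pow (a := (p : ℝ) - 1) (by have := p.coe_nonneg; linarith) S.card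
  rw [add_sub_cancel] at hb
  linarith

lemma integral_abs_cind_le' (S : Finset (Fin n)) :
    ∫ ω, |cind p S ω| ∂ prodBern n p hp ≤ 2 * (p : ℝ) ^ S.card := by
  refine (integral_mono Integrable.of_finite Integrable.of_finite (abs_cind_le S)).trans ?_
  rw [integral_add Integrable.of_finite Integrable.of_finite, integral_ind]
  simp; linarith

lemma p_pow_le (hp : p ≤ 1) {a b : ℕ} (h : a ≤ b) : (p : ℝ) ^ b ≤ (p : ℝ) ^ a :=
  pow_le_pow_of_le_one p.coe_nonneg (by exact_mod_cast hp) h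

lemma integral_abs_cind2_le' (S T : Finset (Fin n)) :
    ∫ ω, |cind p S ω * cind p T ω| ∂ prodBern n p hp ≤ 4 * (p : ℝ) ^ (S ∪ T).card := by
  have : ∀ ω, |cind p S ω * cind p T ω| ≤ ind (S ∪ T) ω + (p : ℝ) ^ T.card * ind S ω
      + (p : ℝ) ^ S.card * ind T ω + (p : ℝ) ^ (S.card + T.card) := by
    intro ω
    rw [abs_mul, ← ind_mul, pow_add]
    have := mul_le_mul (abs_cind_le (p := p) S ω) (abs_cind_le (p := p) T ω) (abs_nonneg _)
      (by have := ind_nonneg S ω; positivity)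
    linarith
  refine (integral_mono Integrable.of_finite Integrable.of_finite this).trans ?_
  rw [integral_add Integrable.of_finite Integrable.of_finite,
    integral_add Integrable.of_finite Integrable.of_finite,
    integral_add Integrable.of_finite Integrable.of_finite,
    integral_const_mul, integral_const_mul, integral_ind, integral_ind, integral_ind]
  simp
  have h := p_pow_le hp (Finset.card_union_le S T)
  rw [mul_comm ((p : ℝ) ^ T.card), ← pow_add]
  linarith

lemma integral_abs_cind3_le' (S T U : Finset (Fin n)) :
    ∫ ω, |cind p S ω * cind p T ω| * |cind p U ω| ∂ prodBern n p hp
      ≤ 8 * (p : ℝ) ^ (S ∪ T ∪ U).card := by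
  have : ∀ ω, |cind p S ω * cind p T ω| * |cind p U ω| ≤ ind (S ∪ T ∪ U) ω
      + (p : ℝ) ^ T.card * ind (S ∪ U) ω
      + (p : ℝ) ^ S.card * ind (T ∪ U) ω + (p : ℝ) ^ (S.card + T.card) * ind U ω
      + (p : ℝ) ^ U.card * ind (S ∪ T) ω
      + (p : ℝ) ^ (T.card + U.card) * ind S ω
      + (p : ℝ) ^ (S.card + U.card) * ind T ω
      + (p : ℝ) ^ (S.card + T.card + U.card) := by
    intro ω
    rw [abs_mul]
    simp only [← ind_mul, pow_add]
    have h1 := ind_nonneg S ω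
    have h2 := ind_nonneg T ω
    have := mul_le_mul (mul_le_mul (abs_cind_le (p := p) S ω) (abs_cind_le (p := p) T ω)
      (abs_nonneg _) (by positivity)) (abs_cind_le (p := p) U ω) (abs_nonneg _) (by positivity)
    refine this.trans (le_of_eq (by ring))
  refine (integral_mono Integrable.of_finite Integrable.of_finite this).trans ?_
  simp only [integral_add Integrable.of_finite Integrable.of_finite, integral_const_mul,
    integral_ind]
  simp only [← pow_add]
  simp only [integral_const, probReal_univ, one_smul]
  have c0 := Finset.card_union_le S T
  have c1 := Finset.card_union_le (S ∪ T) U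
  have c2 : (S ∪ T ∪ U).card ≤ (S ∪ U).card + T.card := by
    rw [Finset.union_right_comm]; exact Finset.card_union_le _ _
  have c3 : (S ∪ T ∪ U).card ≤ S.card + (T ∪ U).card := by
    rw [Finset.union_assoc]; exact Finset.card_union_le _ _
  have h1 := p_pow_le hp (show (S ∪ T ∪ U).card ≤ T.card + (S ∪ U).card by omega)
  have h2 := p_pow_le hp (show (S ∪ T ∪ U).card ≤ S.card + (T ∪ U).card by omega)
  have h3 := p_pow_le hp (show (S ∪ T ∪ U).card ≤ S.card + T.card + U.card by omega)
  have h4 := p_pow_le hp (show (S ∪ T ∪ U).card ≤ U.card + (S ∪ T).card by omega)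
  have h5 := p_pow_le hp (show (S ∪ T ∪ U).card ≤ T.card + U.card + S.card by omega)
  have h6 := p_pow_le hp (show (S ∪ T ∪ U).card ≤ S.card + U.card + T.card by omega)
  linarith

/-- The constant in the third moment bounds. -/
noncomputable def cM (m : ℕ) : ℝ := 16 + 2 * m * 8 ^ m

lemma half_aux {m : ℕ} (hhalf : 1 / 2 ≤ (p : ℝ)) (S T U : Finset (Fin n))
    (hS : S.card ≤ m) (hT : T.card ≤ m) (hU : U.card ≤ m) :
    1 ≤ 8 ^ m * (p : ℝ) ^ (S ∪ T ∪ U).card := by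
  have c : (S ∪ T ∪ U).card ≤ 3 * m := by
    have c0 := Finset.card_union_le S T
    have c1 := Finset.card_union_le (S ∪ T) U
    omega
  calc (1 : ℝ) = 8 ^ m * ((1 / 2) ^ (3 * m)) := by
        rw [pow_mul, ← mul_pow]; norm_num
    _ ≤ 8 ^ m * ((1 / 2) ^ (S ∪ T ∪ U).card) := by
        gcongr ?_ * ?_
        exact pow_le_pow_of_le_one (by norm_num) (by norm_num) c
    _ ≤ _ := by gcongr

lemma final_aux (hp : p ≤ 1) {m : ℕ} {X : ℝ} (S T U : Finset (Fin n))
    (hS : S.card ≤ m) (hT : T.card ≤ m) (hU : U.card ≤ m)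
    (h1 : X ≤ 8 * (p : ℝ) ^ (S ∪ T ∪ U).card)
    (h2 : X ≤ 2 * S.card * (1 - p)) : X ≤ cM m * (1 - p) * (p : ℝ) ^ (S ∪ T ∪ U).card := by
  have hp' : (p : ℝ) ≤ 1 := by exact_mod_cast hp
  have hp1 : 0 ≤ 1 - (p : ℝ) := by linarith
  have hpp : 0 ≤ (p : ℝ) ^ (S ∪ T ∪ U).card := by positivity
  unfold cM
  rcases le_total (1 / 2) (p : ℝ) with hh | hh
  · have a := half_aux hh S T U hS hT hU
    have hSm : (S.card : ℝ) ≤ m := by exact_mod_cast hS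
    calc X ≤ 2 * S.card * (1 - p) := h2
      _ ≤ 2 * m * (1 - p) := by gcongr
      _ = 2 * m * (1 - p) * 1 := by ring
      _ ≤ 2 * m * (1 - p) * (8 ^ m * (p : ℝ) ^ (S ∪ T ∪ U).card) := by gcongr
      _ ≤ _ := by nlinarith [mul_nonneg hp1 hpp]
  · have : 8 * (p : ℝ) ^ (S ∪ T ∪ U).card ≤ 16 * (1 - p) * (p : ℝ) ^ (S ∪ T ∪ U).card := by
      gcongr; linarith
    have h3 : 0 ≤ 2 * m * 8 ^ m * (1 - p) * (p : ℝ) ^ (S ∪ T ∪ U).card := by positivity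
    nlinarith

lemma integral_cind3_bound {m : ℕ} (S T U : Finset (Fin n))
    (hS : S.card ≤ m) (hT : T.card ≤ m) (hU : U.card ≤ m) :
    ∫ ω, |cind p S ω * cind p T ω| * |cind p U ω| ∂ prodBern n p hp
      ≤ cM m * (1 - p) * (p : ℝ) ^ (S ∪ T ∪ U).card := by
  refine final_aux hp S T U hS hT hU (integral_abs_cind3_le' S T U) ?_
  refine le_trans ?_ (integral_abs_cind_le (hp := hp) S)
  refine integral_mono Integrable.of_finite Integrable.of_finite fun ω => ?_
  simp only [abs_mul]
  have h1 := abs_cind_le_one hp T ω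
  have h2 := abs_cind_le_one hp U ω
  have h3 := abs_nonneg (cind p S ω)
  calc _ ≤ |cind p S ω| * 1 * 1 := by gcongr
    _ = _ := by ring

lemma integral_cind21_bound {m : ℕ} (S T U : Finset (Fin n))
    (hS : S.card ≤ m) (hT : T.card ≤ m) (hU : U.card ≤ m) :
    (∫ ω, |cind p S ω * cind p T ω| ∂ prodBern n p hp) * ∫ ω, |cind p U ω| ∂ prodBern n p hp
      ≤ cM m * (1 - p) * (p : ℝ) ^ (S ∪ T ∪ U).card := by
  have n1 : 0 ≤ ∫ ω, |cind p U ω| ∂ prodBern n p hp := integral_nonneg fun _ => abs_nonneg _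
  have n2 : 0 ≤ ∫ ω, |cind p S ω * cind p T ω| ∂ prodBern n p hp :=
    integral_nonneg fun _ => abs_nonneg _
  refine final_aux hp S T U hS hT hU ?_ ?_
  · have := mul_le_mul (integral_abs_cind2_le' (hp := hp) S T) (integral_abs_cind_le' (hp := hp) U)
      n1 (by positivity)
    have h3 := p_pow_le hp (Finset.card_union_le (S ∪ T) U)
    rw [pow_add] at h3
    linarith
  · have a1 : ∫ ω, |cind p U ω| ∂ prodBern n p hp ≤ 1 := by
      refine (integral_mono Integrable.of_finite Integrable.of_finite
        (abs_cind_le_one hp U)).trans ?_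
      simp
    have a2 : ∫ ω, |cind p S ω * cind p T ω| ∂ prodBern n p hp ≤ 2 * S.card * (1 - p) := by
      refine le_trans ?_ (integral_abs_cind_le (hp := hp) S)
      refine integral_mono Integrable.of_finite Integrable.of_finite fun ω => ?_
      simp only [abs_mul]
      have h1 := abs_cind_le_one hp T ω
      exact mul_le_of_le_one_right (abs_nonneg _) h1
    nlinarith

end

section
variable {n : ℕ} {p : ℝ≥0} {hp : p ≤ 1} {V : Type*} [Fintype V] (s : V → Finset (Fin n))

lemma sum_ind_sub (ω : Fin n → Bool) :
    (∑ x, ind (s x) ω) - ∫ ω', (∑ x, ind (s x) ω') ∂ prodBern n p hp = ∑ x, cind p (s x) ω := by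
  rw [integral_finsetSum _ (fun _ _ => Integrable.of_finite)]
  simp only [integral_ind, cind, Finset.sum_sub_distrib]

lemma variance_sum_ind :
    variance (fun ω => ∑ x, ind (s x) ω) (prodBern n p hp)
      = ∑ x, ∑ y ∈ univ.filter (fun y => ¬ Disjoint (s x) (s y)),
          ((p : ℝ) ^ (s x ∪ s y).card - (p : ℝ) ^ ((s x).card + (s y).card)) := by
  rw [variance_eq_integral (measurable_of_finite _).aemeasurable]
  simp_rw [sum_ind_sub, sq, Finset.sum_mul_sum]
  rw [integral_finsetSum _ (fun _ _ => Integrable.of_finite)]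
  refine Finset.sum_congr rfl fun x _ => ?_
  rw [integral_finsetSum _ (fun _ _ => Integrable.of_finite)]
  simp only [integral_cind_mul]
  symm
  apply Finset.sum_subset (Finset.filter_subset _ _)
  intro y _ hy
  simp only [Finset.mem_filter, Finset.mem_univ, true_and, not_not] at hy
  rw [Finset.card_union_of_disjoint hy, sub_self]

lemma variance_ge :
    (1 - (p : ℝ)) * ∑ x, ∑ y ∈ univ.filter (fun y => ¬ Disjoint (s x) (s y)),
          (p : ℝ) ^ (s x ∪ s y).card
      ≤ variance (fun ω => ∑ x, ind (s x) ω) (prodBern n p hp) := by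
  rw [variance_sum_ind, Finset.mul_sum]
  refine Finset.sum_le_sum fun x _ => ?_
  rw [Finset.mul_sum]
  refine Finset.sum_le_sum fun y hy => ?_
  simp only [Finset.mem_filter, Finset.mem_univ, true_and] at hy
  have h1 : (s x ∪ s y).card + 1 ≤ (s x).card + (s y).card := by
    have := Finset.card_union_add_card_inter (s x) (s y)
    have h2 : 0 < (s x ∩ s y).card := by
      rw [Finset.card_pos]
      exact Finset.not_disjoint_iff_nonempty_inter.1 hy
    omega
  have := p_pow_le hp h1
  rw [pow_succ] at this
  linarith

lemma dep_term_bound {V : Type*} (s : V → Finset (Fin n)) (m : ℕ) (hs : ∀ x, (s x).card ≤ m) (σ : ℝ) (hσ : 0 < σ)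
    (μ : Measure (Fin n → Bool)) (hμ : μ = prodBern n p hp)
    (ξ : V → (Fin n → Bool) → ℝ) (hξ : ξ = fun x ω => cind p (s x) ω / σ) (x y z : V) :
    (∫ ω, |ξ x ω * ξ y ω| * |ξ z ω| ∂μ) + (∫ ω, |ξ x ω * ξ y ω| ∂μ) * ∫ ω, |ξ z ω| ∂μ
      ≤ 2 * cM m * (1 - p) / σ ^ 3 * ((p : ℝ) ^ (s x ∪ s y).card *
            (p : ℝ) ^ (s z \ (s x ∪ s y)).card) := by
  subst hμ
  have h1 := integral_cind3_bound (hp := hp) (s x) (s y) (s z) (hs x) (hs y) (hs z)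
  have h2 := integral_cind21_bound (hp := hp) (s x) (s y) (s z) (hs x) (hs y) (hs z)
  have hcard : (s x ∪ s y ∪ s z).card = (s x ∪ s y).card + (s z \ (s x ∪ s y)).card := by
    rw [← Finset.card_union_of_disjoint Finset.disjoint_sdiff, Finset.union_sdiff_self_eq_union]
  have a1 : ∫ ω, |ξ x ω * ξ y ω| * |ξ z ω| ∂ prodBern n p hp
      = (1 / σ ^ 3) * ∫ ω, |cind p (s x) ω * cind p (s y) ω| * |cind p (s z) ω| ∂ prodBern n p hp := by
    rw [← integral_const_mul]; congr 1; ext ω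
    simp only [hξ, abs_mul, abs_div, abs_of_pos hσ]
    field_simp
  have a2 : ∫ ω, |ξ x ω * ξ y ω| ∂ prodBern n p hp
      = (1 / σ ^ 2) * ∫ ω, |cind p (s x) ω * cind p (s y) ω| ∂ prodBern n p hp := by
    rw [← integral_const_mul]; congr 1; ext ω
    simp only [hξ, abs_mul, abs_div, abs_of_pos hσ]
    field_simp
  have a3 : ∫ ω, |ξ z ω| ∂ prodBern n p hp = (1 / σ) * ∫ ω, |cind p (s z) ω| ∂ prodBern n p hp := by
    rw [← integral_const_mul]; congr 1; ext ω
    simp only [hξ, abs_div, abs_of_pos hσ]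
    field_simp
  rw [a1, a2, a3, ← pow_add, ← hcard]
  have h3 : 0 < 1 / σ ^ 3 := by positivity
  have := mul_le_mul_of_nonneg_left (add_le_add h1 h2) h3.le
  refine le_trans (le_of_eq ?_) (this.trans (le_of_eq ?_))
  · field_simp
  · ring

lemma depSum_bound (m : ℕ) (hs : ∀ x, (s x).card ≤ m) (hp1 : p < 1) (K : ℝ)
    (hK : ∀ U : Finset (Fin n), U.card ≤ 2 * m →
      ∑ z ∈ univ.filter (fun z => ¬ Disjoint (s z) U), (p : ℝ) ^ (s z \ U).card ≤ K)
    (σ : ℝ) (hσ : 0 < σ)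
    (hσ2 : variance (fun ω => ∑ x, ind (s x) ω) (prodBern n p hp) = σ ^ 2)
    (r : V → V → Prop) (hr : ∀ x y, r x y ↔ ¬ Disjoint (s x) (s y))
    (μ : Measure (Fin n → Bool)) (hμ : μ = prodBern n p hp)
    (ξ : V → (Fin n → Bool) → ℝ) (hξ : ξ = fun x ω => cind p (s x) ω / σ) :
    depSum μ r ξ ≤ 2 * cM m * (K / σ) := by
  have hp' : (p : ℝ) < 1 := by exact_mod_cast hp1
  have hp1' : 0 < 1 - (p : ℝ) := by linarith
  have hcM : 0 ≤ cM m := by unfold cM; positivity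
  have hpair : ∑ x, ∑ y ∈ univ.filter (fun y => r x y), (p : ℝ) ^ (s x ∪ s y).card
      ≤ σ ^ 2 / (1 - p) := by
    rw [le_div_iff₀ hp1', mul_comm, ← hσ2]
    simp only [hr]
    exact variance_ge s
  have hKnn : 0 ≤ K := (Finset.sum_nonneg fun _ _ => by positivity).trans (hK ∅ (by simp))
  calc depSum μ r ξ ≤ ∑ x, ∑ y ∈ univ.filter (fun y => r x y),
          ∑ z ∈ univ.filter (fun z => r x z ∨ r y z),
          2 * cM m * (1 - p) / σ ^ 3 * ((p : ℝ) ^ (s x ∪ s y).card *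
            (p : ℝ) ^ (s z \ (s x ∪ s y)).card) :=
        Finset.sum_le_sum fun x _ => Finset.sum_le_sum fun y _ =>
          Finset.sum_le_sum fun z _ => dep_term_bound s m hs σ hσ μ hμ ξ hξ x y z
    _ = ∑ x, ∑ y ∈ univ.filter (fun y => r x y),
          2 * cM m * (1 - p) / σ ^ 3 * ((p : ℝ) ^ (s x ∪ s y).card *
          ∑ z ∈ univ.filter (fun z => r x z ∨ r y z), (p : ℝ) ^ (s z \ (s x ∪ s y)).card) := by
        refine Finset.sum_congr rfl fun x _ => Finset.sum_congr rfl fun y _ => ?_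
        rw [Finset.mul_sum, Finset.mul_sum]
    _ ≤ ∑ x, ∑ y ∈ univ.filter (fun y => r x y),
          2 * cM m * (1 - p) / σ ^ 3 * ((p : ℝ) ^ (s x ∪ s y).card * K) := by
        refine Finset.sum_le_sum fun x _ => Finset.sum_le_sum fun y _ => ?_
        gcongr
        refine le_trans (le_of_eq ?_) (hK (s x ∪ s y) ?_)
        · refine Finset.sum_congr ?_ fun _ _ => rfl
          ext z
          simp only [hr, Finset.mem_filter, Finset.mem_univ, true_and,
            Finset.disjoint_union_right]
          rw [disjoint_comm (a := s x), disjoint_comm (a := s y)]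
          tauto
        · have := Finset.card_union_le (s x) (s y)
          have := hs x
          have := hs y
          omega
    _ = 2 * cM m * (1 - p) / σ ^ 3 * K *
          ∑ x, ∑ y ∈ univ.filter (fun y => r x y), (p : ℝ) ^ (s x ∪ s y).card := by
        simp only [Finset.mul_sum]
        refine Finset.sum_congr rfl fun x _ => Finset.sum_congr rfl fun y _ => ?_
        ring
    _ ≤ 2 * cM m * (1 - p) / σ ^ 3 * K * (σ ^ 2 / (1 - p)) := by gcongr
    _ = _ := by field_simp

theorem bern_clt_bound (m : ℕ) (hs : ∀ x, (s x).card ≤ m) (hp1 : p < 1) (K : ℝ)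
    (hK : ∀ U : Finset (Fin n), U.card ≤ 2 * m →
      ∑ z ∈ univ.filter (fun z => ¬ Disjoint (s z) U), (p : ℝ) ^ (s z \ U).card ≤ K)
    (σ : ℝ) (hσ : 0 < σ)
    (hσ2 : variance (fun ω => ∑ x, ind (s x) ω) (prodBern n p hp) = σ ^ 2) (t : ℝ) :
    ‖(∫ ω, Complex.exp (Complex.I * ((t * (((∑ x, ind (s x) ω) -
        ∫ ω', (∑ x, ind (s x) ω') ∂ prodBern n p hp) / σ) : ℝ) : ℂ)) ∂ prodBern n p hp)
      - Complex.exp (-(t : ℂ) ^ 2 / 2)‖ ≤ 4 * cM m * |t| ^ 3 * (K / σ) := by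
  obtain ⟨μ, hμ⟩ : ∃ μ, μ = prodBern n p hp := ⟨_, rfl⟩
  obtain ⟨r, hr⟩ : ∃ r : V → V → Prop, ∀ x y, r x y ↔ ¬ Disjoint (s x) (s y) :=
    ⟨_, fun _ _ => Iff.rfl⟩
  obtain ⟨ξ, hξ⟩ : ∃ ξ : V → (Fin n → Bool) → ℝ, ξ = fun x ω => cind p (s x) ω / σ := ⟨_, rfl⟩
  have : IsProbabilityMeasure μ := by rw [hμ]; infer_instance
  rw [← hμ]
  have hp' : (p : ℝ) < 1 := by exact_mod_cast hp1
  have hp1' : 0 < 1 - (p : ℝ) := by linarith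
  have hcM : 0 ≤ cM m := by unfold cM; positivity
  have hdep : ∀ (t : ℝ) (Z : Finset V) (S : Finset (Fin n)), (∀ z ∈ Z, Disjoint S (s z)) →
      DependsOn (fun ω => Complex.exp (Complex.I *
      ((t * ∑ z ∈ Z, ξ z ω : ℝ) : ℂ))) ((Sᶜ : Finset (Fin n)) : Set (Fin n)) := by
    intro t Z S hq ω ω' hω
    have : ∑ z ∈ Z, ξ z ω = ∑ z ∈ Z, ξ z ω' := by
      refine Finset.sum_congr rfl fun z hz => ?_
      simp only [hξ]
      congr 1
      refine cind_dependsOn _ fun i hi => hω i ?_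
      simp only [Finset.coe_compl, Set.mem_compl_iff, Finset.mem_coe]
      intro hiS
      exact (Finset.disjoint_left.1 (hq z hz)) hiS hi
    simp only [this]
  have hmain := tikh μ r ξ ?_ ?_ ?_ t
  · have e1 : ∀ ω, ((∑ x, ind (s x) ω) - ∫ ω', (∑ x, ind (s x) ω') ∂ μ) / σ = ∑ z, ξ z ω := by
      intro ω
      rw [hμ, sum_ind_sub, Finset.sum_div, hξ]
    simp_rw [e1]
    refine hmain.trans ?_
    have hDbound : depSum μ r ξ ≤ 2 * cM m * (K / σ) :=
      depSum_bound s m hs hp1 K hK σ hσ hσ2 r hr μ hμ ξ hξ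
    have ht : 0 ≤ |t| ^ 3 := by positivity
    nlinarith [mul_le_mul_of_nonneg_right hDbound ht]
  · intro t x
    have := integral_mul_of_disjoint (p := p) (hp := hp) (S := s x) (T := (s x)ᶜ)
      (F := fun ω => ((ξ x ω : ℝ) : ℂ)) (G := fun ω => Complex.exp (Complex.I *
      ((t * ∑ z ∈ univ.filter (fun z => ¬ r x z), ξ z ω : ℝ) : ℂ))) disjoint_compl_right
      (fun ω ω' h => by simp only [hξ]; rw [cind_dependsOn _ h])
      (hdep t _ _ (fun z hz => by
        rw [Finset.mem_filter, hr, not_not] at hz; exact hz.2))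
    rw [hμ, this]
    have h0 : ∫ ω, ((ξ x ω : ℝ) : ℂ) ∂ prodBern n p hp = 0 := by
      rw [integral_complex_ofReal]
      simp only [hξ, integral_div, integral_cind]
      simp
    rw [h0, zero_mul]
  · intro t x y
    have := integral_mul_of_disjoint (p := p) (hp := hp) (S := s x ∪ s y) (T := (s x ∪ s y)ᶜ)
      (F := fun ω => ((ξ x ω * ξ y ω : ℝ) : ℂ)) (G := fun ω => Complex.exp (Complex.I *
      ((t * ∑ z ∈ univ.filter (fun z => ¬ (r x z ∨ r y z)), ξ z ω : ℝ) : ℂ))) disjoint_compl_right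
      (fun ω ω' h => by
        simp only [hξ]
        rw [cind_dependsOn (s x) (fun i hi => h i (by simp [hi])),
          cind_dependsOn (s y) (fun i hi => h i (by simp [hi]))])
      (hdep t _ _ (fun z hz => by
        rw [Finset.mem_filter, not_or, hr, hr, not_not, not_not] at hz
        exact Finset.disjoint_union_left.2 hz.2))
    rw [hμ, this, integral_complex_ofReal]
  · have := variance_sum_ind (hp := hp) s
    rw [hσ2] at this
    have e2 : ∀ x y, ∫ ω, ξ x ω * ξ y ω ∂μ
        = (1 / σ ^ 2) * ((p : ℝ) ^ (s x ∪ s y).card - (p : ℝ) ^ ((s x).card + (s y).card)) := by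
      intro x y
      rw [← integral_cind_mul (hp := hp), ← integral_const_mul]
      congr 1; ext ω
      simp only [hξ]; field_simp
    simp_rw [e2, ← Finset.mul_sum]
    simp only [hr]
    rw [← this]
    field_simp

end

lemma card_le_pow_finrank {β : Type*} [Fintype β] {n : ℕ} (D : ℕ) :
    ∀ (W : Submodule ℚ (β → ℚ)), Module.finrank ℚ W = D →
    ∀ (F : Finset (β → Fin n)),
    (∀ x ∈ F, ∀ y ∈ F, (fun j => (((x j : ℕ) : ℚ)) - ((y j : ℕ) : ℚ)) ∈ W) →
    F.card ≤ n ^ D := by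
  induction D with
  | zero =>
    intro W hW F hF
    rw [pow_zero, Finset.card_le_one]
    intro x hx y hy
    have hbot : W = ⊥ := Submodule.finrank_eq_zero.mp hW
    have h := hF x hx y hy
    rw [hbot, Submodule.mem_bot] at h
    funext j
    have := congrFun h j
    simp only [Pi.zero_apply, sub_eq_zero, Nat.cast_inj] at this
    exact Fin.ext this
  | succ D ih =>
    intro W hW F hF
    have hne : W ≠ ⊥ := by
      rintro rfl
      simp at hW
    obtain ⟨w, hw, hw0⟩ := Submodule.exists_mem_ne_zero_of_ne_bot hne
    obtain ⟨i, hi⟩ := Function.ne_iff.mp hw0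
    let g : W →ₗ[ℚ] ℚ := (LinearMap.proj i).domRestrict W
    have hg : g ⟨w, hw⟩ ≠ 0 := hi
    have hrange : LinearMap.range g = ⊤ := by
      apply LinearMap.range_eq_top.mpr
      apply LinearMap.surjective
      intro h0
      rw [h0] at hg
      exact hg rfl
    have hk := LinearMap.finrank_range_add_finrank_ker g
    rw [hrange, finrank_top, Module.finrank_self, hW] at hk
    have hW' : Module.finrank ℚ ((LinearMap.ker g).map W.subtype) = D := by
      rw [Submodule.finrank_map_subtype_eq]
      omega
    have hfib : ∀ a : Fin n, (F.filter (fun x => x i = a)).card ≤ n ^ D := by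
      intro a
      apply ih _ hW'
      intro x hx y hy
      rw [Finset.mem_filter] at hx hy
      refine ⟨⟨_, hF x hx.1 y hy.1⟩, ?_, rfl⟩
      show (((x i : ℕ) : ℚ)) - ((y i : ℕ) : ℚ) = 0
      rw [hx.2, hy.2, sub_self]
    rw [Finset.card_eq_sum_card_fiberwise (f := fun x => x i) (t := Finset.univ) (by simp)]
    calc _ ≤ ∑ a : Fin n, n ^ D := Finset.sum_le_sum (fun a _ => hfib a)
      _ = n ^ (D+1) := by simp [pow_succ, mul_comm]

noncomputable section

def kerQ {α β : Type*} [Fintype β] (B : Matrix α β ℤ) : Submodule ℚ (β → ℚ) :=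
  LinearMap.ker (B.map (Int.cast : ℤ → ℚ)).mulVecLin

def resQ {β : Type*} (Q : Finset β) : (β → ℚ) →ₗ[ℚ] (Q → ℚ) :=
  LinearMap.funLeft ℚ ℚ (Subtype.val : Q → β)

def kap {α β : Type*} [Fintype β] (B : Matrix α β ℤ) (Q : Finset β) : ℕ :=
  Module.finrank ℚ (kerQ B ⊓ LinearMap.ker (resQ Q) : Submodule ℚ (β → ℚ))

def pii {α β : Type*} [Fintype β] (B : Matrix α β ℤ) (Q : Finset β) : ℕ :=
  Module.finrank ℚ ((kerQ B).map (resQ Q))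

def dimK {α β : Type*} [Fintype β] (B : Matrix α β ℤ) : ℕ := Module.finrank ℚ (kerQ B)

end

lemma finrank_map_add_inf {V V' : Type*} [AddCommGroup V] [Module ℚ V] [AddCommGroup V']
    [Module ℚ V'] [FiniteDimensional ℚ V] (f : V →ₗ[ℚ] V') (K : Submodule ℚ V) :
    Module.finrank ℚ (K ⊓ LinearMap.ker f : Submodule ℚ V) + Module.finrank ℚ (K.map f)
      = Module.finrank ℚ K := by
  have h := LinearMap.finrank_range_add_finrank_ker (f.domRestrict K)
  rw [LinearMap.range_domRestrict] at h
  rw [← h, add_comm]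
  congr 1
  rw [← Submodule.map_comap_subtype, Submodule.finrank_map_subtype_eq]
  rfl

section
variable {α β : Type*} [Fintype α] [Fintype β] (B : Matrix α β ℤ) (Q : Finset β)

lemma kap_add_pii {α β : Type*} [Fintype β] (B : Matrix α β ℤ) (Q : Finset β) :
    kap B Q + pii B Q = dimK B := finrank_map_add_inf _ _

lemma rkZ_add_dimK : rkZ B + dimK B = Fintype.card β := by
  have := LinearMap.finrank_range_add_finrank_ker (B.map (Int.cast : ℤ → ℚ)).mulVecLin
  rw [Module.finrank_fintype_fun_eq_card] at this
  exact this

lemma mem_kerQ {α β : Type*} [Fintype β] (B : Matrix α β ℤ) (w : β → ℚ) :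
    w ∈ kerQ B ↔ ∀ i, ∑ j, (B i j : ℚ) * w j = 0 := by
  unfold kerQ
  rw [LinearMap.mem_ker, Matrix.mulVecLin_apply, funext_iff]
  rfl

lemma dimK_colSub {α β : Type*} [Fintype β] (B : Matrix α β ℤ) (Q : Finset β) :
    dimK (colSub B Qᶜ) = kap B Q := by
  have h := finrank_map_add_inf (resQ Qᶜ) (kerQ B ⊓ LinearMap.ker (resQ Q))
  have hbot : (kerQ B ⊓ LinearMap.ker (resQ Q)) ⊓ LinearMap.ker (resQ Qᶜ) = ⊥ := by
    rw [eq_bot_iff]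
    rintro w ⟨⟨-, h1⟩, h2⟩
    rw [Submodule.mem_bot]
    funext j
    by_cases hj : j ∈ Q
    · exact congrFun (LinearMap.mem_ker.mp h1) ⟨j, hj⟩
    · exact congrFun (LinearMap.mem_ker.mp h2) ⟨j, Finset.mem_compl.mpr hj⟩
  rw [hbot, finrank_bot, zero_add] at h
  unfold kap dimK
  rw [← h]
  have key : kerQ (colSub B Qᶜ) = (kerQ B ⊓ LinearMap.ker (resQ Q)).map (resQ Qᶜ) := by
    ext v
    rw [Submodule.mem_map, mem_kerQ]
    constructor
    · intro hv
      refine ⟨fun j => if hj : j ∈ Qᶜ then v ⟨j, hj⟩ else 0, ⟨?_, ?_⟩, ?_⟩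
      · refine (mem_kerQ _ _).mpr ?_
        intro i
        refine Eq.trans ?_ (hv i)
        rw [← Finset.sum_subset (Finset.subset_univ Qᶜ), ← Finset.sum_coe_sort Qᶜ]
        · apply Finset.sum_congr rfl
          intro j _
          simp only [colSub, Matrix.submatrix_apply, id, j.2, dif_pos]
        · intro j _ hj
          simp only [hj, dif_neg, not_false_eq_true, mul_zero]
      · refine LinearMap.mem_ker.mpr ?_
        funext j
        have : (j : β) ∉ Qᶜ := by simp
        show (if hj : (j : β) ∈ Qᶜ then v ⟨j, hj⟩ else 0) = 0
        rw [dif_neg this]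
      · funext j
        show (if hj : (j : β) ∈ Qᶜ then v ⟨j, hj⟩ else 0) = v j
        rw [dif_pos j.2]
    · rintro ⟨w, ⟨h1, h2⟩, rfl⟩ i
      have h1' := (mem_kerQ _ _).mp h1 i
      refine Eq.trans ?_ h1'
      rw [← Finset.sum_subset (Finset.subset_univ Qᶜ), ← Finset.sum_coe_sort Qᶜ]
      · rfl
      · intro j _ hj
        have hj' : j ∈ Q := by simpa using hj
        have : w j = 0 := congrFun (LinearMap.mem_ker.mp h2) ⟨j, hj'⟩
        rw [this, mul_zero]
  rw [key]

lemma pii_le {α β : Type*} [Fintype β] (B : Matrix α β ℤ) (Q : Finset β) : pii B Q ≤ Q.card := by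
  have := Submodule.finrank_le ((kerQ B).map (resQ Q))
  rw [Module.finrank_fintype_fun_eq_card, Fintype.card_coe] at this
  exact this

lemma rank_lemma : rQ B Q + pii B Q = Q.card := by
  have h1 := rkZ_add_dimK B
  have h2 := rkZ_add_dimK (colSub B Qᶜ)
  have h3 := dimK_colSub B Q
  have h4 := kap_add_pii B Q
  have h5 := pii_le B Q
  have h6 : Fintype.card (↥(Qᶜ)) = Fintype.card β - Q.card := by
    rw [Fintype.card_coe, Finset.card_compl]
  have h7 := Finset.card_le_univ Q
  unfold rQ
  omega
end

section
variable {α β : Type*} [Fintype β] (B : Matrix α β ℤ) (Q : Finset β)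

/-- the integer point attached to an index vector -/
def tz {β : Type*} {n : ℕ} (y : β → Fin n) : β → ℤ := fun j => ((y j : ℕ) : ℤ) + 1

lemma sub_mem_kerQ (b : α → ℤ) {n : ℕ} (x y : β → Fin n) (hx : B.mulVec (tz x) = b)
    (hy : B.mulVec (tz y) = b) :
    (fun j => (((x j : ℕ) : ℚ)) - ((y j : ℕ) : ℚ)) ∈ kerQ B := by
  rw [mem_kerQ]
  intro i
  have h : ∑ j, B i j * tz x j = ∑ j, B i j * tz y j := by
    have h1 := congrFun hx i
    have h2 := congrFun hy i
    exact h1.trans h2.symm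
  have h' : ∑ j, B i j * (((x j : ℕ) : ℤ) - ((y j : ℕ) : ℤ)) = 0 := by
    rw [← sub_eq_zero, ← Finset.sum_sub_distrib] at h
    rw [← h]
    apply Finset.sum_congr rfl
    intro j _
    unfold tz
    ring
  exact_mod_cast h'

lemma count_fix (b : α → ℤ) {n : ℕ} (F : Finset (β → Fin n))
    (hF : ∀ y ∈ F, B.mulVec (tz y) = b) (hQ : ∀ x ∈ F, ∀ y ∈ F, ∀ j ∈ Q, x j = y j) :
    F.card ≤ n ^ kap B Q := by
  refine card_le_pow_finrank _ _ rfl F ?_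
  intro x hx y hy
  refine ⟨sub_mem_kerQ B b x y (hF x hx) (hF y hy), ?_⟩
  refine LinearMap.mem_ker.mpr ?_
  funext j
  show (((x j : ℕ) : ℚ)) - ((y j : ℕ) : ℚ) = 0
  rw [hQ x hx y hy j j.2, sub_self]

lemma count_proj (b : α → ℤ) {n : ℕ} (F : Finset (β → Fin n))
    (hF : ∀ y ∈ F, B.mulVec (tz y) = b) :
    (F.image (fun y => fun j : Q => y j)).card ≤ n ^ pii B Q := by
  refine card_le_pow_finrank _ _ rfl _ ?_
  intro x hx y hy
  obtain ⟨x, hx', rfl⟩ := Finset.mem_image.mp hx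
  obtain ⟨y, hy', rfl⟩ := Finset.mem_image.mp hy
  exact ⟨_, sub_mem_kerQ B b x y (hF x hx') (hF y hy'), rfl⟩

lemma pii_pos (hB : IsPositiveMat B) (hQ : Q.Nonempty) : 0 < pii B Q := by
  obtain ⟨⟨x, hx, hx0⟩, -⟩ := hB
  obtain ⟨j, hj⟩ := hQ
  unfold pii
  rw [Module.finrank_pos_iff, Submodule.nontrivial_iff_ne_bot]
  intro h
  have hm : (fun j => (x j : ℚ)) ∈ kerQ B := by
    rw [mem_kerQ]
    intro i
    have := congrFun hx i
    have h' : ∑ j, B i j * x j = 0 := this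
    exact_mod_cast h'
  have h3 : resQ Q (fun j => (x j : ℚ)) ∈ (kerQ B).map (resQ Q) := ⟨_, hm, rfl⟩
  rw [h, Submodule.mem_bot] at h3
  have h4 : (x j : ℚ) = 0 := congrFun h3 ⟨j, hj⟩
  have := hx0 j
  have h5 : x j = 0 := by exact_mod_cast h4
  omega
end

section
variable {α β : Type*} [Fintype β] (B : Matrix α β ℤ)

lemma abs_le_sum_abs' {ι : Type*} [Fintype ι] (x : ι → ℤ) (k : ι) : |x k| ≤ ∑ l, |x l| :=
  Finset.single_le_sum (f := fun l => |x l|) (fun _ _ => abs_nonneg _) (Finset.mem_univ k)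

lemma exists_pos_distinct (hB : IsPositiveMat B) :
    ∃ w : β → ℤ, B.mulVec w = 0 ∧ (∀ j, 0 < w j) ∧ Function.Injective w := by
  have key : ∀ T : Finset (β × β), ∃ w : β → ℤ, B.mulVec w = 0 ∧ (∀ j, 0 < w j) ∧
      ∀ q ∈ T, q.1 ≠ q.2 → w q.1 ≠ w q.2 := by
    intro T
    induction T using Finset.induction_on with
    | empty =>
      obtain ⟨⟨x, hx, hx0⟩, -⟩ := hB
      exact ⟨x, hx, hx0, by simp⟩
    | insert q T hq ih =>
      obtain ⟨g, hg, hg0, hgT⟩ := ih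
      by_cases hgq : q.1 ≠ q.2 → g q.1 ≠ g q.2
      · refine ⟨g, hg, hg0, ?_⟩
        intro q' hq'
        rcases Finset.mem_insert.mp hq' with rfl | h
        · exact hgq
        · exact hgT q' h
      · push Not at hgq
        obtain ⟨hne, heq⟩ := hgq
        obtain ⟨x, hx, hxne⟩ := hB.2 q.1 q.2 hne
        set N : ℤ := 1 + 2 * ∑ l, |x l| with hN
        have hxa : ∀ k, 2 * |x k| < N := by
          intro k
          have := abs_le_sum_abs' x k
          omega
        have hN0 : 0 < N := by
          have := hxa q.1
          have := abs_nonneg (x q.1)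
          omega
        refine ⟨N • g + x, ?_, ?_, ?_⟩
        · rw [Matrix.mulVec_add, Matrix.mulVec_smul, hg, hx]; simp
        · intro j
          have h1 := hg0 j
          have h2 := hxa j
          have h3 := neg_abs_le (x j)
          simp only [Pi.add_apply, Pi.smul_apply, smul_eq_mul]
          nlinarith [abs_nonneg (x j)]
        · intro q' hq' hne' he
          simp only [Pi.add_apply, Pi.smul_apply, smul_eq_mul] at he
          rcases Finset.mem_insert.mp hq' with rfl | h
          · rw [heq] at he
            exact hxne (by linarith)
          · have h4 := hgT q' h hne'
            have h5 : N * |g q'.1 - g q'.2| = |x q'.2 - x q'.1| := by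
              have h10 : N * (g q'.1 - g q'.2) = x q'.2 - x q'.1 := by linarith
              rw [← h10, abs_mul, abs_of_pos hN0]
            have h6 : 1 ≤ |g q'.1 - g q'.2| := Int.one_le_abs (sub_ne_zero.mpr h4)
            have h7 := abs_sub (x q'.2) (x q'.1)
            have h8 := hxa q'.1
            have h9 := hxa q'.2
            nlinarith
  obtain ⟨w, h1, h2, h3⟩ := key Finset.univ
  refine ⟨w, h1, h2, ?_⟩
  intro i j hij
  by_contra hne
  exact h3 (i, j) (Finset.mem_univ _) hne hij

lemma exists_int_multiple (u : β → ℚ) : ∃ (N : ℤ) (v : β → ℤ), N ≠ 0 ∧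
    ∀ j, (v j : ℚ) = N * u j := by
  refine ⟨∏ j, ((u j).den : ℤ), fun j => (∏ k ∈ Finset.univ.erase j, ((u k).den : ℤ)) * (u j).num,
    ?_, ?_⟩
  · exact Finset.prod_ne_zero_iff.mpr (fun j _ => by exact_mod_cast (u j).den_nz)
  · intro j
    rw [← Finset.mul_prod_erase Finset.univ _ (Finset.mem_univ j)]
    push_cast
    have h : ((u j).den : ℚ) * u j = (u j).num := Rat.den_mul_eq_num (u j)
    rw [← h]
    ring

lemma exists_int_basis : ∃ v : Fin (dimK B) → β → ℤ, (∀ i, B.mulVec (v i) = 0) ∧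
    ∀ t t' : Fin (dimK B) → ℤ, (∀ k, ∑ i, t i * v i k = ∑ i, t' i * v i k) → t = t' := by
  obtain ⟨e⟩ : Nonempty (Module.Basis (Fin (dimK B)) ℚ (kerQ B)) :=
    ⟨Module.finBasis ℚ (kerQ B)⟩
  choose N v hN hv using fun i => exists_int_multiple ((e i : kerQ B) : β → ℚ)
  refine ⟨v, ?_, ?_⟩
  · intro i
    funext a
    have h1 := (mem_kerQ B _).mp (e i).2 a
    have h2 : ∑ j, (B a j : ℚ) * (v i j : ℚ) = 0 := by
      calc ∑ j, (B a j : ℚ) * (v i j : ℚ)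
          = N i * ∑ j, (B a j : ℚ) * ((e i : kerQ B) : β → ℚ) j := by
            rw [Finset.mul_sum]
            apply Finset.sum_congr rfl
            intro j _
            rw [hv]; ring
        _ = 0 := by rw [h1, mul_zero]
    have h3 : ∑ j, B a j * v i j = 0 := by exact_mod_cast h2
    exact h3
  · intro t t' h
    have hli := Fintype.linearIndependent_iff.mp e.linearIndependent
      (fun i => ((t i - t' i : ℤ) : ℚ) * N i) (by
        apply Subtype.ext
        funext k
        rw [AddSubmonoidClass.coe_finsetSum, Finset.sum_apply]
        have hk := h k
        rw [← sub_eq_zero, ← Finset.sum_sub_distrib] at hk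
        have hk' : ((∑ i, (t i * v i k - t' i * v i k) : ℤ) : ℚ) = 0 := by rw [hk]; rfl
        show _ = (0 : ℚ)
        rw [← hk', Int.cast_sum]
        apply Finset.sum_congr rfl
        intro i _
        show ((t i - t' i : ℤ) : ℚ) * N i * ((e i : kerQ B) : β → ℚ) k = _
        push_cast
        rw [hv i k]
        ring)
    funext i
    have := hli i
    have hNi : (N i : ℚ) ≠ 0 := by exact_mod_cast hN i
    have h3 := (mul_eq_zero.mp this).resolve_right hNi
    have h4 : t i - t' i = 0 := by exact_mod_cast h3
    omega

lemma exists_points (hB : IsPositiveMat B) (b : α → ℤ) (hb : ∃ y0 : β → ℤ, B.mulVec y0 = b) :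
    ∃ C : ℕ, 0 < C ∧ ∀ n L : ℕ, 0 < L → C * L ≤ n → ∃ F : Finset (β → Fin n),
      (∀ y ∈ F, B.mulVec (tz y) = b ∧ Function.Injective y) ∧ F.card = L ^ dimK B := by
  obtain ⟨w, hw, hw0, hwi⟩ := exists_pos_distinct B hB
  obtain ⟨v, hv, hvi⟩ := exists_int_basis B
  obtain ⟨y0, hy0⟩ := hb
  set M : ℤ := ∑ k, |y0 k| with hM
  set U : ℤ := ∑ i, ∑ k, |v i k| with hU
  set W : ℤ := ∑ k, |w k| with hW
  have hM0 : 0 ≤ M := Finset.sum_nonneg (fun _ _ => abs_nonneg _)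
  have hU0 : 0 ≤ U := Finset.sum_nonneg (fun _ _ => Finset.sum_nonneg (fun _ _ => abs_nonneg _))
  have hW0 : 0 ≤ W := Finset.sum_nonneg (fun _ _ => abs_nonneg _)
  have hCpos : 0 < (W+1) * (2 * M + 2 * U + 1) := by positivity
  refine ⟨((W+1) * (2 * M + 2 * U + 1)).toNat, by omega, ?_⟩
  intro n L hL hCL
  have hCL' : (W+1) * (2 * M + 2 * U + 1) * L ≤ n := by
    have : ((((W+1) * (2 * M + 2 * U + 1)).toNat : ℕ) : ℤ) * L ≤ n := by exact_mod_cast hCL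
    rwa [Int.toNat_of_nonneg hCpos.le] at this
  have hL1 : (1 : ℤ) ≤ L := by exact_mod_cast hL
  set T : ℤ := 2 * (M + L * U) + 1 with hT
  have hTn : (W + 1) * T ≤ n := by
    refine le_trans ?_ hCL'
    rw [mul_assoc]
    apply mul_le_mul_of_nonneg_left _ (by positivity)
    rw [hT]
    nlinarith
  let Y : (Fin (dimK B) → Fin L) → β → ℤ := fun t k =>
    y0 k + T * w k + ∑ i, ((t i : ℕ) : ℤ) * v i k
  have hsmall : ∀ (t : Fin (dimK B) → Fin L) (k : β), |y0 k + ∑ i, ((t i : ℕ) : ℤ) * v i k| ≤ M + L * U := by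
    intro t k
    refine (abs_add_le _ _).trans (add_le_add (abs_le_sum_abs' y0 k) ?_)
    refine (Finset.abs_sum_le_sum_abs _ _).trans ?_
    rw [hU, Finset.mul_sum]
    apply Finset.sum_le_sum
    intro i _
    rw [abs_mul, Nat.abs_cast]
    apply mul_le_mul _ (abs_le_sum_abs' (v i) k) (abs_nonneg _) (by positivity)
    exact_mod_cast (t i).2.le
  have hT0 : 0 < T := by positivity
  have hlow : ∀ t k, 1 ≤ Y t k := by
    intro t k
    have h1 := neg_le_of_abs_le (hsmall t k)
    have h2 := hw0 k
    have h3 : T ≤ T * w k := by nlinarith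
    have h4 : 0 ≤ M + L * U := by positivity
    simp only [Y]
    omega
  have hhigh : ∀ t k, Y t k ≤ n := by
    intro t k
    have h1 := le_of_abs_le (hsmall t k)
    have h2 : w k ≤ W := (le_abs_self _).trans (abs_le_sum_abs' w k)
    have h3 : T * w k ≤ T * W := mul_le_mul_of_nonneg_left h2 hT0.le
    simp only [Y]
    have h4 : 0 ≤ M + L * U := by positivity
    nlinarith
  let y : (Fin (dimK B) → Fin L) → β → Fin n := fun t k =>
    ⟨(Y t k - 1).toNat, by have := hlow t k; have := hhigh t k; omega⟩
  have htz : ∀ t, tz (y t) = Y t := by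
    intro t
    funext k
    have := hlow t k
    simp only [tz, y]
    omega
  have hyinj : Function.Injective y := by
    intro t t' h
    have h1 : Y t = Y t' := by rw [← htz, ← htz, h]
    have h2 := hvi (fun i => ((t i : ℕ) : ℤ)) (fun i => ((t' i : ℕ) : ℤ)) (by
      intro k
      have := congrFun h1 k
      simp only [Y] at this
      linarith)
    funext i
    have h3 := congrFun h2 i
    simp only [Nat.cast_inj] at h3
    exact Fin.ext h3
  refine ⟨Finset.univ.image y, ?_, ?_⟩
  · intro z hz
    obtain ⟨t, -, rfl⟩ := Finset.mem_image.mp hz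
    constructor
    · rw [htz]
      have : Y t = y0 + T • w + ∑ i, ((t i : ℕ) : ℤ) • v i := by
        funext k
        simp [Y, Finset.sum_apply]
      rw [this, Matrix.mulVec_add, Matrix.mulVec_add, Matrix.mulVec_smul, hw, hy0,
        Matrix.mulVec_sum]
      simp only [Matrix.mulVec_smul, hv, smul_zero, Finset.sum_const_zero, add_zero]
    · intro k l hkl
      by_contra hne
      have h1 : Y t k = Y t l := by rw [← htz]; simp only [tz, hkl]
      have h2 := hsmall t k
      have h3 := hsmall t l
      have h4 : T * (w k - w l) = (y0 l + ∑ i, ((t i : ℕ) : ℤ) * v i l)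
          - (y0 k + ∑ i, ((t i : ℕ) : ℤ) * v i k) := by
        simp only [Y] at h1
        linarith
      have h5 : T * |w k - w l| ≤ 2 * (M + L * U) := by
        have h6 := abs_sub (y0 l + ∑ i, ((t i : ℕ) : ℤ) * v i l)
          (y0 k + ∑ i, ((t i : ℕ) : ℤ) * v i k)
        rw [← h4, abs_mul, abs_of_pos hT0] at h6
        linarith
      have h7 : 1 ≤ |w k - w l| := Int.one_le_abs (sub_ne_zero.mpr (fun h => hne (hwi h)))
      nlinarith
  · rw [Finset.card_image_of_injective _ hyinj]
    simp

lemma lower_count (hB : IsPositiveMat B) (b : α → ℤ) (hb : ∃ y0 : β → ℤ, B.mulVec y0 = b) :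
    ∃ c : ℝ, 0 < c ∧ ∀ᶠ n : ℕ in atTop, ∃ F : Finset (β → Fin n),
      (∀ y ∈ F, B.mulVec (tz y) = b ∧ Function.Injective y) ∧
      c * (n : ℝ) ^ dimK B ≤ F.card := by
  obtain ⟨C, hC, h⟩ := exists_points B hB b hb
  refine ⟨(1 / (2 * (C : ℝ))) ^ dimK B, by positivity, ?_⟩
  filter_upwards [eventually_ge_atTop C] with n hn
  have hL : 0 < n / C := Nat.div_pos hn hC
  obtain ⟨F, hF, hcard⟩ := h n (n / C) hL (Nat.mul_div_le n C)
  refine ⟨F, hF, ?_⟩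
  rw [hcard, ← mul_pow]
  push_cast
  apply pow_le_pow_left₀ (by positivity)
  have h1 : n < C * (n / C + 1) := by
    have := Nat.lt_mul_div_succ n hC
    exact this
  have h2 : n ≤ 2 * C * (n / C) := by nlinarith
  have h3 : (n : ℝ) ≤ 2 * C * ((n / C : ℕ) : ℝ) := by exact_mod_cast h2
  have hC' : (0 : ℝ) < C := by exact_mod_cast hC
  rw [div_mul_eq_mul_div, one_mul, div_le_iff₀ (by positivity)]
  linarith
end

section
variable {α β : Type*} [Fintype β] (B : Matrix α β ℤ) (b : α → ℤ) {n : ℕ}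

lemma card_image_sdiff (y : β → Fin n) (hy : Function.Injective y) (U : Finset (Fin n)) :
    (univ.image y \ U).card = Fintype.card β - (univ.filter (fun c => y c ∈ U)).card := by
  have h : univ.image y \ U = (univ.filter (fun c => y c ∈ U))ᶜ.image y := by
    ext a
    simp only [Finset.mem_sdiff, Finset.mem_image, Finset.mem_univ, true_and, Finset.mem_compl,
      Finset.mem_filter]
    constructor
    · rintro ⟨⟨c, rfl⟩, h⟩; exact ⟨c, h, rfl⟩
    · rintro ⟨c, h, rfl⟩; exact ⟨⟨c, rfl⟩, h⟩
  rw [h, Finset.card_image_of_injective _ hy, Finset.card_compl]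

lemma count_hit (F : Finset (β → Fin n)) (hF : ∀ y ∈ F, B.mulVec (tz y) = b) (Q : Finset β)
    (U : Finset (Fin n)) (M : ℕ) (hU : U.card ≤ M) (hM : 1 ≤ M) :
    (F.filter (fun y => ∀ c ∈ Q, y c ∈ U)).card ≤ M ^ Fintype.card β * n ^ kap B Q := by
  set F' := F.filter (fun y => ∀ c ∈ Q, y c ∈ U) with hF'
  let T : Finset (Q → Fin n) := Fintype.piFinset (fun _ => U)
  have hmap : ∀ y ∈ F', (fun j : Q => y j) ∈ T := by
    intro y hy
    rw [Fintype.mem_piFinset]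
    intro j
    exact (Finset.mem_filter.mp hy).2 j j.2
  rw [Finset.card_eq_sum_card_fiberwise (s := F')
    (f := fun (y : β → Fin n) (j : Q) => y j) (t := T) hmap]
  calc _ ≤ ∑ u ∈ T, n ^ kap B Q := by
        apply Finset.sum_le_sum
        intro u _
        apply count_fix B Q b
        · intro y hy
          exact hF y (Finset.mem_filter.mp (Finset.mem_filter.mp hy).1).1
        · intro x hx y hy j hj
          have h1 := congrFun (Finset.mem_filter.mp hx).2 ⟨j, hj⟩
          have h2 := congrFun (Finset.mem_filter.mp hy).2 ⟨j, hj⟩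
          exact h1.trans h2.symm
    _ = T.card * n ^ kap B Q := by simp
    _ ≤ _ := by
        apply Nat.mul_le_mul_right
        have : T.card = U.card ^ Q.card := by
          simp [T, Fintype.card_piFinset]
        rw [this]
        exact (Nat.pow_le_pow_left hU _).trans (Nat.pow_le_pow_right hM (Finset.card_le_univ Q))

lemma K_bound (p : ℝ≥0) (F : Finset (β → Fin n))
    (hF : ∀ y ∈ F, B.mulVec (tz y) = b ∧ Function.Injective y)
    (U : Finset (Fin n)) (M : ℕ) (hU : U.card ≤ M) (hM : 1 ≤ M) :
    ∑ y ∈ F.filter (fun y => ¬ Disjoint (univ.image y) U), (p : ℝ) ^ (univ.image y \ U).card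
      ≤ ∑ Q ∈ (univ : Finset (Finset β)).filter (fun Q => Q.Nonempty),
        (M : ℝ) ^ Fintype.card β * ((n : ℝ) ^ kap B Q * (p : ℝ) ^ (Fintype.card β - Q.card)) := by
  set F' := F.filter (fun y => ¬ Disjoint (univ.image y) U) with hF'
  have hmap : ∀ y ∈ F', univ.filter (fun c => y c ∈ U) ∈
      (univ : Finset (Finset β)).filter (fun Q => Q.Nonempty) := by
    intro y hy
    have := (Finset.mem_filter.mp hy).2
    rw [Finset.not_disjoint_iff] at this
    obtain ⟨a, ha, haU⟩ := this
    obtain ⟨c, -, rfl⟩ := Finset.mem_image.mp ha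
    refine Finset.mem_filter.mpr ⟨Finset.mem_univ _, ⟨c, ?_⟩⟩
    simpa using haU
  rw [← Finset.sum_fiberwise_of_maps_to hmap]
  apply Finset.sum_le_sum
  intro Q _
  calc _ ≤ ∑ y ∈ F'.filter (fun y => univ.filter (fun c => y c ∈ U) = Q),
          (p : ℝ) ^ (Fintype.card β - Q.card) := by
        apply Finset.sum_le_sum
        intro y hy
        obtain ⟨h1, h2⟩ := Finset.mem_filter.mp hy
        rw [card_image_sdiff y (hF y (Finset.mem_filter.mp h1).1).2 U, h2]
    _ = ((F'.filter (fun y => univ.filter (fun c => y c ∈ U) = Q)).card : ℝ) *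
          (p : ℝ) ^ (Fintype.card β - Q.card) := by rw [Finset.sum_const, nsmul_eq_mul]
    _ ≤ _ := by
        rw [← mul_assoc]
        apply mul_le_mul_of_nonneg_right _ (by positivity)
        have h1 : (F'.filter (fun y => univ.filter (fun c => y c ∈ U) = Q)).card ≤
            (F.filter (fun y => ∀ c ∈ Q, y c ∈ U)).card := by
          apply Finset.card_le_card
          intro y hy
          obtain ⟨h1, h2⟩ := Finset.mem_filter.mp hy
          refine Finset.mem_filter.mpr ⟨(Finset.mem_filter.mp h1).1, ?_⟩
          intro c hc
          rw [← h2] at hc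
          exact (Finset.mem_filter.mp hc).2
        have h2 := h1.trans (count_hit B b F (fun y hy => (hF y hy).1) Q U M hU hM)
        exact_mod_cast h2

lemma pair_bound (F : Finset (β → Fin n)) (hF : ∀ y ∈ F, B.mulVec (tz y) = b) (Q : Finset β) :
    F.card ^ 2 ≤ n ^ pii B Q * ∑ y ∈ F, (F.filter (fun y' => ∀ j ∈ Q, y j = y' j)).card := by
  let ρ : (β → Fin n) → (Q → Fin n) := fun y j => y j
  have hρ : ∀ y y', ρ y' = ρ y ↔ ∀ j ∈ Q, y j = y' j := by
    intro y y'
    constructor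
    · intro h j hj; exact (congrFun h ⟨j, hj⟩).symm
    · intro h; funext j; exact (h j j.2).symm
  have h1 : ∑ y ∈ F, (F.filter (fun y' => ∀ j ∈ Q, y j = y' j)).card
      = ∑ u ∈ F.image ρ, (F.filter (fun y => ρ y = u)).card ^ 2 := by
    rw [← Finset.sum_fiberwise_of_maps_to (g := ρ) (t := F.image ρ)
      (fun y hy => Finset.mem_image_of_mem _ hy)]
    apply Finset.sum_congr rfl
    intro u _
    rw [sq, ← smul_eq_mul, ← Finset.sum_const]
    apply Finset.sum_congr rfl
    intro y hy
    have hy2 := (Finset.mem_filter.mp hy).2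
    congr 1
    apply Finset.filter_congr
    intro y' _
    rw [← hρ, hy2]
  rw [h1, Finset.card_eq_sum_card_fiberwise (f := ρ) (t := F.image ρ)
    (fun y hy => Finset.mem_image_of_mem _ hy)]
  exact sq_sum_le_card_mul_sum_sq.trans
    (Nat.mul_le_mul_right _ (count_proj B Q b F hF))

lemma card_union_image (y y' : β → Fin n) (Q : Finset β) (h : ∀ j ∈ Q, y j = y' j) :
    (univ.image y ∪ univ.image y').card ≤ 2 * Fintype.card β - Q.card := by
  have h1 : univ.image y ∪ univ.image y' ⊆ univ.image y ∪ Qᶜ.image y' := by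
    intro a ha
    rcases Finset.mem_union.mp ha with h2 | h2
    · exact Finset.mem_union_left _ h2
    · obtain ⟨c, -, rfl⟩ := Finset.mem_image.mp h2
      by_cases hc : c ∈ Q
      · rw [← h c hc]
        exact Finset.mem_union_left _ (Finset.mem_image_of_mem _ (Finset.mem_univ _))
      · exact Finset.mem_union_right _ (Finset.mem_image_of_mem _ (Finset.mem_compl.mpr hc))
  have h2 := Finset.card_le_card h1
  have h3 := Finset.card_union_le (univ.image y) (Qᶜ.image y')
  have h4 : (univ.image y).card ≤ Fintype.card β := Finset.card_image_le
  have h5 : (Qᶜ.image y').card ≤ Qᶜ.card := Finset.card_image_le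
  have h6 := Finset.card_compl Q
  have h7 := Finset.card_le_univ Q
  omega

lemma var_lower {p : ℝ≥0} {hp : p ≤ 1} {V : Type*} [Fintype V] (s : V → Finset (Fin n))
    (G : Finset V) (γ : V → β → Fin n) (hγ : Set.InjOn γ G)
    (hG : ∀ x ∈ G, B.mulVec (tz (γ x)) = b ∧ Function.Injective (γ x))
    (hs : ∀ x ∈ G, s x = univ.image (γ x)) (Q : Finset β) (hQ : Q.Nonempty) :
    (1 - (p : ℝ)) * (p : ℝ) ^ (2 * Fintype.card β - Q.card) * (G.card : ℝ) ^ 2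
      ≤ (n : ℝ) ^ pii B Q * variance (fun ω => ∑ x, ind (s x) ω) (prodBern n p hp) := by
  have hv := variance_ge (p := p) (hp := hp) s
  have hp1 : 0 ≤ 1 - (p : ℝ) := by
    have : (p : ℝ) ≤ 1 := by exact_mod_cast hp
    linarith
  have hpb := pair_bound B b (G.image γ) (by
    intro y hy
    obtain ⟨x, hx, rfl⟩ := Finset.mem_image.mp hy
    exact (hG x hx).1) Q
  rw [Finset.card_image_of_injOn hγ, Finset.sum_image hγ] at hpb
  have hpb' : ((G.card : ℝ)) ^ 2 ≤ (n : ℝ) ^ pii B Q *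
      ∑ x ∈ G, (((G.image γ).filter (fun y' => ∀ j ∈ Q, γ x j = y' j)).card : ℝ) := by
    exact_mod_cast hpb
  have hsum : (p : ℝ) ^ (2 * Fintype.card β - Q.card) *
      ∑ x ∈ G, (((G.image γ).filter (fun y' => ∀ j ∈ Q, γ x j = y' j)).card : ℝ)
      ≤ ∑ x, ∑ y ∈ univ.filter (fun y => ¬ Disjoint (s x) (s y)), (p:ℝ)^(s x ∪ s y).card := by
    rw [Finset.mul_sum]
    refine le_trans ?_ (Finset.sum_le_sum_of_subset_of_nonneg (Finset.subset_univ G)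
      (fun _ _ _ => Finset.sum_nonneg (fun _ _ => by positivity)))
    apply Finset.sum_le_sum
    intro x hx
    have hcard : ((G.image γ).filter (fun y' => ∀ j ∈ Q, γ x j = y' j)).card ≤
        (G.filter (fun x' => ∀ j ∈ Q, γ x j = γ x' j)).card := by
      rw [Finset.filter_image]
      exact Finset.card_image_le
    calc _ ≤ (p : ℝ) ^ (2 * Fintype.card β - Q.card) *
          ((G.filter (fun x' => ∀ j ∈ Q, γ x j = γ x' j)).card : ℝ) := by
          apply mul_le_mul_of_nonneg_left _ (by positivity)
          exact_mod_cast hcard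
      _ = ∑ x' ∈ G.filter (fun x' => ∀ j ∈ Q, γ x j = γ x' j),
          (p : ℝ) ^ (2 * Fintype.card β - Q.card) := by
          rw [Finset.sum_const, nsmul_eq_mul, mul_comm]
      _ ≤ ∑ x' ∈ G.filter (fun x' => ∀ j ∈ Q, γ x j = γ x' j), (p:ℝ)^(s x ∪ s x').card := by
          apply Finset.sum_le_sum
          intro x' hx'
          obtain ⟨h1, h2⟩ := Finset.mem_filter.mp hx'
          rw [hs x hx, hs x' h1]
          exact p_pow_le hp (card_union_image _ _ Q h2)
      _ ≤ _ := by
          apply Finset.sum_le_sum_of_subset_of_nonneg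
          · intro x' hx'
            obtain ⟨h1, h2⟩ := Finset.mem_filter.mp hx'
            refine Finset.mem_filter.mpr ⟨Finset.mem_univ _, ?_⟩
            obtain ⟨j, hj⟩ := hQ
            rw [Finset.not_disjoint_iff, hs x hx, hs x' h1]
            refine ⟨γ x j, Finset.mem_image_of_mem _ (Finset.mem_univ _), ?_⟩
            rw [h2 j hj]
            exact Finset.mem_image_of_mem _ (Finset.mem_univ _)
          · intros; positivity
  calc _ ≤ (1 - (p : ℝ)) * (p : ℝ) ^ (2 * Fintype.card β - Q.card) * ((n : ℝ) ^ pii B Q *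
      ∑ x ∈ G, (((G.image γ).filter (fun y' => ∀ j ∈ Q, γ x j = y' j)).card : ℝ)) :=
        mul_le_mul_of_nonneg_left hpb' (by positivity)
    _ = (n : ℝ) ^ pii B Q * ((1 - (p : ℝ)) * ((p : ℝ) ^ (2 * Fintype.card β - Q.card) *
      ∑ x ∈ G, (((G.image γ).filter (fun y' => ∀ j ∈ Q, γ x j = y' j)).card : ℝ))) := by ring
    _ ≤ _ := by
        apply mul_le_mul_of_nonneg_left _ (by positivity)
        exact (mul_le_mul_of_nonneg_left hsum hp1).trans hv

lemma term_bound {κ π k q : ℕ} {n c p v : ℝ} (hn : 0 < n) (hp0 : 0 ≤ p)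
    (hqk : q ≤ k) {g : ℝ} (hg : c * n ^ (κ + π) ≤ g) (hc : 0 < c) (hp1 : p ≤ 1)
    (h : (1 - p) * p ^ (2 * k - q) * g ^ 2 ≤ n ^ π * v) :
    (n ^ κ * p ^ (k - q)) ^ 2 * (c ^ 2 * ((1 - p) * (n ^ π * p ^ q))) ≤ v := by
  have h1 : (1 - p) * p ^ (2 * k - q) * (c * n ^ (κ + π)) ^ 2 ≤ n ^ π * v := by
    refine le_trans ?_ h
    apply mul_le_mul_of_nonneg_left
    · exact pow_le_pow_left₀ (by positivity) hg 2
    · have : 0 ≤ 1 - p := by linarith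
      positivity
  have h2 : (1 - p) * p ^ (2 * k - q) * (c * n ^ (κ + π)) ^ 2
      = n ^ π * ((n ^ κ * p ^ (k - q)) ^ 2 * (c ^ 2 * ((1 - p) * (n ^ π * p ^ q)))) := by
    obtain ⟨e, rfl⟩ := Nat.exists_eq_add_of_le hqk
    have e1 : 2 * (q + e) - q = 2 * e + q := by omega
    have e2 : q + e - q = e := by omega
    rw [e1, e2]
    ring
  rw [h2] at h1
  exact le_of_mul_le_mul_left h1 (by positivity)
end

lemma density_le {α β : Type*} [Fintype α] [Fintype β] (B : Matrix α β ℤ) (Q : Finset β)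
    (hQ : Q.Nonempty) : (Q.card : ℝ) / (pii B Q : ℝ) ≤ matDensity B := by
  unfold matDensity
  apply le_csSup
  · apply Set.Finite.bddAbove
    apply (Set.finite_range (fun Q : Finset β =>
      (Q.card : ℝ) / ((Q.card : ℝ) - (rQ B Q : ℝ)))).subset
    rintro x ⟨Q, -, rfl⟩
    exact ⟨Q, rfl⟩
  · refine ⟨Q, hQ, ?_⟩
    congr 1
    have : ((rQ B Q : ℝ)) + pii B Q = Q.card := by exact_mod_cast rank_lemma B Q
    linarith

lemma D_tendsto {α β : Type*} [Fintype α] [Fintype β] (B : Matrix α β ℤ) (hB : IsPositiveMat B)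
    (Q : Finset β) (hQ : Q.Nonempty) (p : ℕ → ℝ≥0) (hp : ∀ n, p n ≤ 1)
    (h1 : Tendsto (fun n : ℕ => (n : ℝ) * (1 - (p n : ℝ))) atTop atTop)
    (h2 : Tendsto (fun n : ℕ => (n : ℝ) * (p n : ℝ) ^ (matDensity B)) atTop atTop) :
    Tendsto (fun n : ℕ => (1 - (p n : ℝ)) * ((n : ℝ) ^ pii B Q * (p n : ℝ) ^ Q.card))
      atTop atTop := by
  have hπ := pii_pos B Q hB hQ
  have hπ' : (0 : ℝ) < pii B Q := by exact_mod_cast hπ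
  rw [tendsto_atTop]
  intro C
  have h2C := tendsto_atTop.mp h2 (2 * |C| + 1)
  have h1C := tendsto_atTop.mp h1 (2 ^ Q.card * |C|)
  filter_upwards [h2C, h1C, eventually_ge_atTop 1] with n hn2 hn1 hn
  have hn' : (1 : ℝ) ≤ n := by exact_mod_cast hn
  have hp0 : (0 : ℝ) ≤ p n := (p n).2
  have hp1 : (p n : ℝ) ≤ 1 := by exact_mod_cast hp n
  have hC := le_abs_self C
  have hC0 := abs_nonneg C
  by_cases hhalf : (p n : ℝ) ≤ 1 / 2
  · have ha : (n : ℝ) * (p n : ℝ) ^ (matDensity B) ≤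
        (n : ℝ) * (p n : ℝ) ^ ((Q.card : ℝ) / (pii B Q : ℝ)) := by
      apply mul_le_mul_of_nonneg_left _ (by positivity)
      exact Real.rpow_le_rpow_of_exponent_ge' hp0 hp1 (by positivity) (density_le B Q hQ)
    have hpow : (n : ℝ) ^ pii B Q * (p n : ℝ) ^ Q.card =
        ((n : ℝ) * (p n : ℝ) ^ ((Q.card : ℝ) / (pii B Q : ℝ))) ^ pii B Q := by
      rw [mul_pow, ← Real.rpow_natCast ((p n : ℝ) ^ _), ← Real.rpow_mul hp0,
        div_mul_cancel₀ _ hπ'.ne', Real.rpow_natCast]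
    have hge : 2 * |C| ≤ (n : ℝ) ^ pii B Q * (p n : ℝ) ^ Q.card := by
      rw [hpow]
      have h3 : 1 ≤ (n : ℝ) * (p n : ℝ) ^ ((Q.card : ℝ) / (pii B Q : ℝ)) := by linarith
      have h4 := le_self_pow₀ h3 hπ.ne'
      linarith
    nlinarith
  · push Not at hhalf
    have h3 : (n : ℝ) ≤ (n : ℝ) ^ pii B Q := le_self_pow₀ hn' hπ.ne'
    have h4 : (1 / 2 : ℝ) ^ Q.card ≤ (p n : ℝ) ^ Q.card :=
      pow_le_pow_left₀ (by norm_num) hhalf.le _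
    have h5 : 0 ≤ 1 - (p n : ℝ) := by linarith
    calc C ≤ |C| := hC
      _ = (1 / 2 : ℝ) ^ Q.card * (2 ^ Q.card * |C|) := by
          rw [← mul_assoc, ← mul_pow]; norm_num
      _ ≤ (1 / 2 : ℝ) ^ Q.card * ((n : ℝ) * (1 - (p n : ℝ))) :=
          mul_le_mul_of_nonneg_left hn1 (by positivity)
      _ = (1 - (p n : ℝ)) * ((n : ℝ) * (1 / 2 : ℝ) ^ Q.card) := by ring
      _ ≤ _ := by
          apply mul_le_mul_of_nonneg_left _ h5
          exact mul_le_mul h3 h4 (by positivity) (by positivity)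

section
variable {α : Type*} {m : ℕ} (A : Matrix α (Fin m) ℤ) (b : α → ℤ) (P : Set (Setoid (Fin m)))

lemma contract_mulVec (s : Setoid (Fin m)) (y : Quotient s → ℤ) :
    (contract A s).mulVec y = A.mulVec (fun j => y (Quotient.mk s j)) := by
  funext i
  show ∑ c, (∑ j ∈ Finset.univ.filter (fun j => Quotient.mk s j = c), A i j) * y c
    = ∑ j, A i j * y (Quotient.mk s j)
  rw [← Finset.sum_fiberwise_of_maps_to (g := fun j => Quotient.mk s j) (t := Finset.univ)
    (fun _ _ => Finset.mem_univ _)]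
  apply Finset.sum_congr rfl
  intro c _
  rw [Finset.sum_mul]
  apply Finset.sum_congr rfl
  intro j hj
  rw [(Finset.mem_filter.mp hj).2]

/-- index vectors of solutions inside `[n]` -/
abbrev Vn (n : ℕ) := {x : Fin m → Fin n // tz x ∈ typeSols A b P}

/-- the realized partitions -/
def realized : Set (Setoid (Fin m)) :=
  {s | s ∈ P ∧ ∃ x : Fin m → ℤ, A.mulVec x = b ∧ Setoid.ker x = s}

noncomputable def gam {V : Type*} {n : ℕ} (s : Setoid (Fin m)) (f : V → Fin m → Fin n) (x : V) :
    Quotient s → Fin n := fun c => f x c.out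

lemma tz_inj_iff {β : Type*} {n : ℕ} (y : β → Fin n) (i j : β) : tz y i = tz y j ↔ y i = y j := by
  unfold tz
  rw [add_left_inj, Nat.cast_inj, Fin.ext_iff]

variable {A b P}

lemma gam_mk {n : ℕ} {s : Setoid (Fin m)} {x : Vn A b P n} (hx : Setoid.ker (tz x.1) = s)
    (j : Fin m) : gam s Subtype.val x (Quotient.mk s j) = x.1 j := by
  unfold gam
  rw [← tz_inj_iff]
  have h : s (Quotient.mk s j).out j := Quotient.mk_out j
  rw [← hx] at h
  rw [← hx]
  exact h

lemma gam_sol {n : ℕ} {s : Setoid (Fin m)} {x : Vn A b P n} (hx : Setoid.ker (tz x.1) = s) :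
    (contract A s).mulVec (tz (gam s Subtype.val x)) = b ∧
      Function.Injective (gam s Subtype.val x) := by
  constructor
  · rw [contract_mulVec]
    refine Eq.trans ?_ x.2.1
    congr 1
    funext j
    exact congrArg (fun a : Fin n => ((a : ℕ) : ℤ) + 1) (gam_mk hx j)
  · intro c c' h
    induction c using Quotient.inductionOn with | _ i
    induction c' using Quotient.inductionOn with | _ j
    rw [gam_mk hx, gam_mk hx, ← tz_inj_iff] at h
    apply Quotient.sound
    show s i j
    rw [← hx]
    exact h

lemma gam_image {n : ℕ} {s : Setoid (Fin m)} {x : Vn A b P n} (hx : Setoid.ker (tz x.1) = s) :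
    univ.image x.1 = univ.image (gam s Subtype.val x) := by
  ext a
  simp only [Finset.mem_image, Finset.mem_univ, true_and]
  constructor
  · rintro ⟨j, rfl⟩
    exact ⟨Quotient.mk s j, gam_mk hx j⟩
  · rintro ⟨c, rfl⟩
    exact ⟨c.out, rfl⟩

lemma gam_injOn {n : ℕ} {s : Setoid (Fin m)} {x x' : Vn A b P n}
    (hx : Setoid.ker (tz x.1) = s) (hx' : Setoid.ker (tz x'.1) = s)
    (h : gam s Subtype.val x = gam s Subtype.val x') : x = x' := by
  apply Subtype.ext
  funext j
  rw [← gam_mk hx, ← gam_mk hx', h]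

lemma exists_of_gam {n : ℕ} {s : Setoid (Fin m)} (hs : s ∈ P) (y : Quotient s → Fin n)
    (hy : (contract A s).mulVec (tz y) = b) (hyi : Function.Injective y) :
    ∃ x : Vn A b P n, Setoid.ker (tz x.1) = s ∧ gam s Subtype.val x = y := by
  have hker : Setoid.ker (tz (fun j => y (Quotient.mk s j))) = s := by
    ext i j
    rw [Setoid.ker_def, tz_inj_iff]
    constructor
    · intro h
      exact Quotient.exact (hyi h)
    · intro h
      exact congrArg y (Quotient.sound h)
  refine ⟨⟨fun j => y (Quotient.mk s j), ?_, ?_⟩, hker, ?_⟩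
  · rw [contract_mulVec] at hy
    exact hy
  · rw [hker]; exact hs
  · funext c
    show y (Quotient.mk s c.out) = y c
    rw [Quotient.out_eq]

variable (A b P)

lemma solCount_eq (n : ℕ) (ω : Fin n → Bool) :
    (solCount (typeSols A b P) n ω : ℝ) = ∑ x : Vn A b P n, ind (univ.image x.1) ω := by
  simp only [ind_eq]
  rw [Finset.sum_boole]
  congr 1
  unfold solCount
  rw [← Fintype.card_subtype, ← Nat.card_eq_fintype_card]
  symm
  apply Nat.card_congr
  refine Equiv.ofBijective (fun x => ⟨tz x.1.1, x.1.2, ?_⟩) ⟨?_, ?_⟩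
  · intro j
    exact ⟨x.1.1 j, rfl, x.2 _ (Finset.mem_image_of_mem _ (Finset.mem_univ _))⟩
  · intro x x' h
    apply Subtype.ext
    apply Subtype.ext
    funext j
    have h1 := congrFun (congrArg Subtype.val h) j
    simp only [tz, add_left_inj, Nat.cast_inj] at h1
    exact Fin.ext h1
  · rintro ⟨x, hx, hsel⟩
    have hsel' := hsel
    choose i hi hω using hsel'
    have : tz i = x := by
      funext j
      rw [hi j]
      rfl
    refine ⟨⟨⟨i, by rw [this]; exact hx⟩, ?_⟩, ?_⟩
    · intro a ha
      obtain ⟨j, -, rfl⟩ := Finset.mem_image.mp ha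
      exact hω j
    · exact Subtype.ext this

instance setoid_finite : Finite (Setoid (Fin m)) :=
  Finite.of_injective (fun s : Setoid (Fin m) => (fun i j => s i j : Fin m → Fin m → Prop))
    (fun s t h => Setoid.ext (fun i j => by
      have := congrFun (congrFun h i) j
      exact iff_of_eq this))

noncomputable def Rz : Finset (Setoid (Fin m)) := (Set.toFinite (realized A b P)).toFinset

lemma mem_Rz (s : Setoid (Fin m)) : s ∈ Rz A b P ↔ s ∈ realized A b P := by
  unfold Rz
  rw [Set.Finite.mem_toFinset]

noncomputable def termK (n : ℕ) (p : ℝ≥0) (s : Setoid (Fin m)) (Q : Finset (Quotient s)) : ℝ :=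
  (n : ℝ) ^ kap (contract A s) Q * (p : ℝ) ^ (Fintype.card (Quotient s) - Q.card)

noncomputable def KK (M : ℕ) (n : ℕ) (p : ℝ≥0) : ℝ :=
  ∑ s ∈ Rz A b P, ∑ Q ∈ (univ : Finset (Finset (Quotient s))).filter (fun Q => Q.Nonempty),
    (M : ℝ) ^ Fintype.card (Quotient s) * termK A n p s Q

lemma KK_bound (M n : ℕ) (hM : 1 ≤ M) (p : ℝ≥0) (U : Finset (Fin n)) (hU : U.card ≤ M) :
    ∑ z ∈ univ.filter (fun z : Vn A b P n => ¬ Disjoint (univ.image z.1) U),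
      (p:ℝ) ^ (univ.image z.1 \ U).card ≤ KK A b P M n p := by
  rw [← Finset.sum_fiberwise_of_maps_to (g := fun z : Vn A b P n => Setoid.ker (tz z.1))
    (t := Rz A b P) (fun z _ => (mem_Rz A b P _).mpr ⟨z.2.2, tz z.1, z.2.1, rfl⟩)]
  unfold KK
  apply Finset.sum_le_sum
  intro s _
  set G := (univ.filter (fun z : Vn A b P n => Setoid.ker (tz z.1) = s)) with hG
  have hGm : ∀ z ∈ G, Setoid.ker (tz z.1) = s := fun z hz => (Finset.mem_filter.mp hz).2
  have hinj : Set.InjOn (gam s (Subtype.val : Vn A b P n → _)) G := by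
    intro x hx x' hx' h
    exact gam_injOn (hGm x hx) (hGm x' hx') h
  have hKb := K_bound (contract A s) b p (G.image (gam s Subtype.val)) (by
    intro y hy
    obtain ⟨x, hx, rfl⟩ := Finset.mem_image.mp hy
    exact gam_sol (hGm x hx)) U M hU hM
  refine le_trans (le_of_eq ?_) hKb
  rw [Finset.filter_image, Finset.sum_image]
  · apply Finset.sum_congr
    · ext z
      simp only [Finset.mem_filter, Finset.mem_univ, true_and, hG]
      constructor
      · rintro ⟨h1, h2⟩
        rw [gam_image h2] at h1
        exact ⟨h2, h1⟩
      · rintro ⟨h1, h2⟩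
        rw [← gam_image h1] at h2
        exact ⟨h2, h1⟩
    · intro z hz
      rw [gam_image (Finset.mem_filter.mp (Finset.mem_filter.mp hz).1).2]
  · intro x hx x' hx' h
    exact hinj (Finset.mem_filter.mp hx).1 (Finset.mem_filter.mp hx').1 h

end

noncomputable def varn {α : Type*} {m : ℕ} (A : Matrix α (Fin m) ℤ) (b : α → ℤ)
    (P : Set (Setoid (Fin m))) (p : ℕ → ℝ≥0) (hp : ∀ n, p n ≤ 1) (n : ℕ) : ℝ :=
  variance (fun ω => ∑ x : Vn A b P n, ind (univ.image x.1) ω) (prodBern n (p n) (hp n))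

section
variable {α : Type*} [Fintype α] {m : ℕ} (A : Matrix α (Fin m) ℤ) (b : α → ℤ)
  (P : Set (Setoid (Fin m))) (p : ℕ → ℝ≥0) (hp : ∀ n, p n ≤ 1)

lemma realized_proper {s : Setoid (Fin m)} (hs : s ∈ realized A b P) :
    ∃ y : Quotient s → ℤ, (contract A s).mulVec y = b ∧ Function.Injective y := by
  obtain ⟨-, x, hx, rfl⟩ := hs
  refine ⟨Quotient.lift x (fun _ _ h => h), ?_, ?_⟩
  · rw [contract_mulVec]
    exact hx
  · intro c c' h
    induction c using Quotient.inductionOn with | _ i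
    induction c' using Quotient.inductionOn with | _ j
    exact Quotient.sound h

lemma term_lower {s : Setoid (Fin m)} (hs : s ∈ realized A b P)
    (hpos : IsPositiveMat (contract A s)) :
    ∃ c : ℝ, 0 < c ∧ ∀ᶠ n : ℕ in atTop, ∀ Q : Finset (Quotient s), Q.Nonempty →
      (termK A n (p n) s Q) ^ 2 * (c ^ 2 * ((1 - (p n : ℝ)) *
        ((n : ℝ) ^ pii (contract A s) Q * (p n : ℝ) ^ Q.card))) ≤ varn A b P p hp n := by
  obtain ⟨y, hy, -⟩ := realized_proper A b P hs
  obtain ⟨c, hc, hev⟩ := lower_count (contract A s) hpos b ⟨y, hy⟩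
  refine ⟨c, hc, ?_⟩
  filter_upwards [hev, eventually_ge_atTop 1] with n hF hn Q hQ
  obtain ⟨F, hF, hcard⟩ := hF
  set G := (univ.filter (fun z : Vn A b P n => Setoid.ker (tz z.1) = s)) with hG
  have hGm : ∀ z ∈ G, Setoid.ker (tz z.1) = s := fun z hz => (Finset.mem_filter.mp hz).2
  have hsub : F ⊆ G.image (gam s Subtype.val) := by
    intro y hy
    obtain ⟨x, hx, rfl⟩ := exists_of_gam hs.1 y (hF y hy).1 (hF y hy).2
    exact Finset.mem_image_of_mem _ (Finset.mem_filter.mpr ⟨Finset.mem_univ _, hx⟩)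
  have hcG : (F.card : ℝ) ≤ G.card := by
    exact_mod_cast (Finset.card_le_card hsub).trans Finset.card_image_le
  have hv := var_lower (contract A s) b (p := p n) (hp := hp n)
    (fun x : Vn A b P n => univ.image x.1) G (gam s Subtype.val)
    (fun x hx x' hx' h => gam_injOn (hGm x hx) (hGm x' hx') h)
    (fun x hx => gam_sol (hGm x hx)) (fun x hx => gam_image (hGm x hx)) Q hQ
  have hn' : (0 : ℝ) < n := by exact_mod_cast hn
  refine term_bound hn' (p n).2 (Finset.card_le_univ Q) (g := (G.card : ℝ)) ?_ hc
    (by exact_mod_cast hp n) hv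
  rw [kap_add_pii]
  exact hcard.trans hcG

lemma ratio_tendsto {t D v : ℕ → ℝ} {c : ℝ} (hc : 0 < c) (ht : ∀ n, 0 ≤ t n)
    (hD : Tendsto D atTop atTop) (h : ∀ᶠ n in atTop, (t n) ^ 2 * (c ^ 2 * D n) ≤ v n) :
    Tendsto (fun n => t n / Real.sqrt (v n)) atTop (𝓝 0) := by
  have hlim : Tendsto (fun n => (c * Real.sqrt (D n))⁻¹) atTop (𝓝 0) := by
    apply Tendsto.inv_tendsto_atTop
    exact Tendsto.const_mul_atTop hc (Real.tendsto_sqrt_atTop.comp hD)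
  refine tendsto_of_tendsto_of_tendsto_of_le_of_le' tendsto_const_nhds hlim ?_ ?_
  · exact Eventually.of_forall (fun n => div_nonneg (ht n) (Real.sqrt_nonneg _))
  · filter_upwards [h, tendsto_atTop.mp hD 1] with n hn hD1
    have hD0 : 0 < Real.sqrt (D n) := Real.sqrt_pos.mpr (by linarith)
    rcases (Real.sqrt_nonneg (v n)).eq_or_lt with h0 | h0
    · rw [← h0, div_zero]; positivity
    · rw [div_le_iff₀ h0, inv_mul_eq_div, le_div_iff₀ (by positivity)]
      apply Real.le_sqrt_of_sq_le
      rw [mul_pow, mul_pow, Real.sq_sqrt (by linarith)]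
      exact hn

lemma termK_nonneg (n : ℕ) (q : ℝ≥0) (s : Setoid (Fin m)) (Q : Finset (Quotient s)) :
    0 ≤ termK A n q s Q := by
  unfold termK
  positivity

lemma KK_ratio (hpos : ∀ s ∈ realized A b P, IsPositiveMat (contract A s))
    (h1 : Tendsto (fun n : ℕ => (n : ℝ) * (1 - (p n : ℝ))) atTop atTop)
    (h2 : ∀ s ∈ realized A b P,
      Tendsto (fun n : ℕ => (n : ℝ) * (p n : ℝ) ^ (matDensity (contract A s))) atTop atTop)
    (M : ℕ) :
    Tendsto (fun n => KK A b P M n (p n) / Real.sqrt (varn A b P p hp n)) atTop (𝓝 0) := by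
  unfold KK
  simp only [Finset.sum_div]
  rw [show (0 : ℝ) = ∑ s ∈ Rz A b P,
    ∑ Q ∈ (univ : Finset (Finset (Quotient s))).filter (fun Q => Q.Nonempty), 0 by simp]
  apply tendsto_finsetSum
  intro s hs
  rw [mem_Rz] at hs
  apply tendsto_finsetSum
  intro Q hQ
  have hQ := (Finset.mem_filter.mp hQ).2
  obtain ⟨c, hc, hev⟩ := term_lower A b P p hp hs (hpos s hs)
  have := (ratio_tendsto hc (fun n => termK_nonneg A n (p n) s Q)
    (D_tendsto (contract A s) (hpos s hs) Q hQ p hp h1 (h2 s hs))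
    (hev.mono (fun n h => h Q hQ))).const_mul ((M : ℝ) ^ Fintype.card (Quotient s))
  rw [mul_zero] at this
  simpa only [mul_div_assoc] using this

lemma varn_pos (hm : 0 < m) {s : Setoid (Fin m)} (hs : s ∈ realized A b P)
    (hpos : IsPositiveMat (contract A s))
    (h1 : Tendsto (fun n : ℕ => (n : ℝ) * (1 - (p n : ℝ))) atTop atTop)
    (h2 : Tendsto (fun n : ℕ => (n : ℝ) * (p n : ℝ) ^ (matDensity (contract A s))) atTop atTop) :
    ∀ᶠ n in atTop, 0 < varn A b P p hp n := by
  obtain ⟨c, hc, hev⟩ := term_lower A b P p hp hs hpos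
  have hQ : (univ : Finset (Quotient s)).Nonempty := ⟨Quotient.mk s ⟨0, hm⟩, Finset.mem_univ _⟩
  have hD := D_tendsto (contract A s) hpos univ hQ p hp h1 h2
  filter_upwards [hev, tendsto_atTop.mp hD 1, eventually_ge_atTop 1] with n hn hD1 hn1
  refine lt_of_lt_of_le ?_ (hn univ hQ)
  have hn' : (0 : ℝ) < n := by exact_mod_cast hn1
  have ht : 0 < termK A n (p n) s univ := by
    unfold termK
    rw [Finset.card_univ, Nat.sub_self, pow_zero, mul_one]
    positivity
  have : 0 < (1 - (p n : ℝ)) * ((n : ℝ) ^ pii (contract A s) univ *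
    (p n : ℝ) ^ (univ : Finset (Quotient s)).card) := by linarith
  positivity

lemma singleton_realized (hA : IsPositiveMat A) (hb : ∃ x : Fin m → ℤ, A.mulVec x = b)
    (hP : singletonSetoid (Fin m) ∈ P) : singletonSetoid (Fin m) ∈ realized A b P := by
  refine ⟨hP, ?_⟩
  obtain ⟨c, hc, hev⟩ := lower_count A hA b hb
  obtain ⟨n, ⟨F, hF, hcard⟩, hn⟩ := (hev.and (eventually_ge_atTop 1)).exists
  have hn' : (0 : ℝ) < n := by exact_mod_cast hn
  have hF0 : 0 < F.card := by
    have : (0 : ℝ) < F.card := lt_of_lt_of_le (by positivity) hcard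
    exact_mod_cast this
  obtain ⟨y, hy⟩ := Finset.card_pos.mp hF0
  refine ⟨tz y, (hF y hy).1, ?_⟩
  ext i j
  rw [Setoid.ker_def, tz_inj_iff]
  exact (hF y hy).2.eq_iff

lemma charfun_tendsto (hm : 0 < m) (hA : IsPositiveMat A)
    (hb : ∃ x : Fin m → ℤ, A.mulVec x = b)
    (hP : singletonSetoid (Fin m) ∈ P)
    (hpos : ∀ s ∈ realized A b P, IsPositiveMat (contract A s))
    (h1 : Tendsto (fun n : ℕ => (n : ℝ) * (1 - (p n : ℝ))) atTop atTop)
    (h2 : ∀ s ∈ realized A b P,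
      Tendsto (fun n : ℕ => (n : ℝ) * (p n : ℝ) ^ (matDensity (contract A s))) atTop atTop)
    (t : ℝ) :
    Tendsto (fun n => ∫ ω, Complex.exp (Complex.I * ((t * (((∑ x : Vn A b P n,
        ind (univ.image x.1) ω) - ∫ ω', (∑ x : Vn A b P n, ind (univ.image x.1) ω')
          ∂ prodBern n (p n) (hp n)) / Real.sqrt (varn A b P p hp n)) : ℝ) : ℂ))
          ∂ prodBern n (p n) (hp n)) atTop (𝓝 (Complex.exp (-(t:ℂ)^2/2))) := by
  have hsr := singleton_realized A b P hA hb hP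
  have hvp := varn_pos A b P p hp hm hsr (hpos _ hsr) h1 (h2 _ hsr)
  rw [tendsto_iff_norm_sub_tendsto_zero]
  have hlim := (KK_ratio A b P p hp hpos h1 h2 (2 * m)).const_mul (4 * cM m * |t| ^ 3)
  rw [mul_zero] at hlim
  refine tendsto_of_tendsto_of_tendsto_of_le_of_le' tendsto_const_nhds hlim
    (Eventually.of_forall (fun n => norm_nonneg _)) ?_
  filter_upwards [hvp, tendsto_atTop.mp h1 1] with n hv hn1
  have hp1 : p n < 1 := by
    refine lt_of_le_of_ne (hp n) ?_
    intro h
    rw [h] at hn1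
    simp at hn1
    linarith
  refine bern_clt_bound (fun x : Vn A b P n => univ.image x.1) m ?_ hp1 (KK A b P (2 * m) n (p n))
    ?_ (Real.sqrt (varn A b P p hp n)) (Real.sqrt_pos.mpr hv) ?_ t
  · intro x
    refine Finset.card_image_le.trans ?_
    simp
  · intro U hU
    exact KK_bound A b P (2 * m) n (by omega) (p n) U hU
  · rw [Real.sq_sqrt hv.le]
    rfl
end

/-- **Theorem (meta theorem: distribution of type-`𝔓` solutions).** -/
theorem typeSolutions_clt {r m : ℕ} (hr : 0 < r) (hrm : r < m)
    (A : Matrix (Fin r) (Fin m) ℤ) (hApos : IsPositiveMat A) (hAab : IsAbundantMat A)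
    (b : Fin r → ℤ) (hb : ∃ x : Fin m → ℤ, A.mulVec x = b)
    (P : Set (Setoid (Fin m))) (hPsub : P ⊆ partitionFamily A)
    (hPsing : singletonSetoid (Fin m) ∈ P)
    (hPpos : ∀ s ∈ P,
      (∃ y : Quotient s → ℤ, (contract A s).mulVec y = b ∧ Function.Injective y) →
        IsPositiveMat (contract A s))
    (p : ℕ → ℝ≥0) (hp : ∀ n, p n ≤ 1)
    (h1 : Tendsto (fun n : ℕ => (n : ℝ) * (1 - (p n : ℝ))) atTop atTop)
    (h2 : ∀ s ∈ P, (∃ x : Fin m → ℤ, A.mulVec x = b ∧ Setoid.ker x = s) →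
      Tendsto (fun n : ℕ => (n : ℝ) * (p n : ℝ) ^ (matDensity (contract A s))) atTop atTop) :
    ∀ f : ℝ →ᵇ ℝ,
      Tendsto (fun n : ℕ =>
          ∫ ω, f (((solCount (typeSols A b P) n ω : ℝ) -
              ∫ ω', (solCount (typeSols A b P) n ω' : ℝ) ∂ prodBern n (p n) (hp n)) /
            Real.sqrt (variance (fun ω' => (solCount (typeSols A b P) n ω' : ℝ))
              (prodBern n (p n) (hp n)))) ∂ prodBern n (p n) (hp n))
        atTop (𝓝 (∫ x, f x ∂ gaussianReal 0 1)) := by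
  intro f
  have hposR : ∀ s ∈ realized A b P, IsPositiveMat (contract A s) :=
    fun s hs => hPpos s hs.1 (realized_proper A b P hs)
  have hchar := charfun_tendsto A b P p hp (by omega) hApos hb hPsing hposR h1
    (fun s hs => h2 s hs.1 hs.2)
  let W : ∀ n : ℕ, (Fin n → Bool) → ℝ := fun n ω => ((∑ x : Vn A b P n,
        ind (univ.image x.1) ω) - ∫ ω', (∑ x : Vn A b P n, ind (univ.image x.1) ω')
          ∂ prodBern n (p n) (hp n)) / Real.sqrt (varn A b P p hp n)
  have hWm : ∀ n, Measurable (W n) := fun n => measurable_of_finite _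
  let μ : ℕ → ProbabilityMeasure ℝ := fun n =>
    ⟨(prodBern n (p n) (hp n)).map (W n),
      Measure.isProbabilityMeasure_map (hWm n).aemeasurable⟩
  let μ₀ : ProbabilityMeasure ℝ := ⟨gaussianReal 0 1, inferInstance⟩
  have hconv : Tendsto μ atTop (𝓝 μ₀) := by
    rw [ProbabilityMeasure.tendsto_iff_tendsto_charFun]
    intro t
    have h0 : charFun (μ₀ : Measure ℝ) t = Complex.exp (-(t:ℂ)^2/2) := by
      show charFun (gaussianReal 0 1) t = _
      rw [charFun_gaussianReal]
      congr 1
      push_cast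
      ring
    rw [h0]
    refine (hchar t).congr (fun n => ?_)
    show _ = charFun ((prodBern n (p n) (hp n)).map (W n)) t
    rw [charFun_apply_real, integral_map (hWm n).aemeasurable (by fun_prop)]
    apply integral_congr_ae
    refine Eventually.of_forall (fun ω => ?_)
    simp only [W]
    congr 1
    push_cast
    ring
  have hfin := (ProbabilityMeasure.tendsto_iff_forall_integral_tendsto.mp hconv) f
  refine hfin.congr (fun n => ?_)
  show ∫ x, f x ∂ ((prodBern n (p n) (hp n)).map (W n)) = _
  rw [integral_map (hWm n).aemeasurable f.continuous.aestronglyMeasurable]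
  simp only [W, varn, solCount_eq]
end

section
/- Let m > r be positive integers, A ∈ ℤ^{r×m} positive, and b ∈ ℤ^r such that S(A,b) ≠ ∅. Then for every Q ⊆ [m] there exists Q' ⊇ Q such that, as n → ∞, |S_0(A ×_{id_{Q'}} A, b²) ∩ [n]^{2m−|Q'|}| = Ω(n^{2m − rk(A) − rk(A^{Q̄}) − |Q|}); that is, there are c > 0 and n_0 with |S_0(A ×_{id_{Q'}} A, b²) ∩ [n]^{2m−|Q'|}| ≥ c · n^{2m − rk(A) − rk(A^{Q̄}) − |Q|} for all n ≥ n_0. -/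
open Matrix Finset MeasureTheory ProbabilityTheory Filter Topology
open scoped BoundedContinuousFunction NNReal ENNReal

attribute [local instance] Classical.propDecidable

/-- Column index type of the compounded matrix `A ×_M B`: the columns of `A` outside `P`,
the merged columns indexed by `P`, and the columns of `B` outside `M(P)`. -/
abbrev compIdx {mA mB : ℕ} (P : Finset (Fin mA)) (M : Fin mA → Fin mB) : Type :=
  ({j : Fin mA // j ∉ P} ⊕ {j : Fin mA // j ∈ P}) ⊕ {j : Fin mB // j ∉ P.image M}

/-- The compounded matrix `A ×_M B`, whose first block row is
`(A^{[mA]∖P} | columns of A indexed by P | 0)` and whose second block row is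
`(0 | columns of B indexed by M(P) | B^{[mB]∖M(P)})`. -/
noncomputable def compMat {rA mA rB mB : ℕ}
    (A : Matrix (Fin rA) (Fin mA) ℤ) (B : Matrix (Fin rB) (Fin mB) ℤ)
    (P : Finset (Fin mA)) (M : Fin mA → Fin mB) :
    Matrix (Fin rA ⊕ Fin rB) (compIdx P M) ℤ :=
  fun i c =>
    match i, c with
    | Sum.inl i, Sum.inl (Sum.inl j) => A i j.1
    | Sum.inl i, Sum.inl (Sum.inr j) => A i j.1
    | Sum.inl _, Sum.inr _ => 0
    | Sum.inr _, Sum.inl (Sum.inl _) => 0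
    | Sum.inr i, Sum.inl (Sum.inr j) => B i (M j.1)
    | Sum.inr i, Sum.inr j => B i j.1


lemma exists_pos_inj {α β : Type*} [Fintype β] (C : Matrix α β ℤ) (h : IsPositiveMat C) :
    ∃ p : β → ℤ, C.mulVec p = 0 ∧ (∀ j, 0 < p j) ∧ Function.Injective p := by
  have key : ∀ s : Finset (β × β), ∃ p : β → ℤ, C.mulVec p = 0 ∧ (∀ j, 0 < p j) ∧
      ∀ q ∈ s, q.1 ≠ q.2 → p q.1 ≠ p q.2 := by
    intro s
    induction s using Finset.induction_on with
    | empty =>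
      obtain ⟨p, hp, hp'⟩ := h.1
      exact ⟨p, hp, hp', by simp⟩
    | insert q s hq ih =>
      obtain ⟨p, hp0, hpp, hps⟩ := ih
      by_cases hne : q.1 ≠ q.2 → p q.1 ≠ p q.2
      · refine ⟨p, hp0, hpp, ?_⟩
        intro q' hq'
        rcases Finset.mem_insert.1 hq' with rfl | h'
        · exact hne
        · exact hps _ h'
      · push Not at hne
        obtain ⟨hne, heq⟩ := hne
        obtain ⟨x, hx0, hx⟩ := h.2 _ _ hne
        have hb : ∀ j, |x j| ≤ ∑ j, |x j| := fun j =>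
          Finset.single_le_sum (f := fun j => |x j|) (fun i _ => abs_nonneg _) (Finset.mem_univ j)
        set X := ∑ j, |x j| with hX
        have hX0 : 0 ≤ X := Finset.sum_nonneg fun i _ => abs_nonneg _
        refine ⟨(2 * X + 1) • p + x, ?_, ?_, ?_⟩
        · rw [Matrix.mulVec_add, Matrix.mulVec_smul, hp0, hx0]; simp
        · intro j
          have h1 := abs_le.1 (hb j)
          have h2 := hpp j
          simp only [Pi.add_apply, Pi.smul_apply, smul_eq_mul]
          nlinarith
        · intro q' hq' hne'
          simp only [Pi.add_apply, Pi.smul_apply, smul_eq_mul]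
          rcases Finset.mem_insert.1 hq' with rfl | h'
          · rw [heq]; intro hh; exact hx (by linarith)
          · have h3 := hps _ h' hne'
            have h1 := abs_le.1 (hb q'.1)
            have h2 := abs_le.1 (hb q'.2)
            rcases lt_or_gt_of_ne h3 with h4 | h4
            · have : (2 * X + 1) * (p q'.1 + 1) ≤ (2 * X + 1) * p q'.2 :=
                mul_le_mul_of_nonneg_left (by linarith) (by linarith)
              intro hh; linarith
            · have : (2 * X + 1) * (p q'.2 + 1) ≤ (2 * X + 1) * p q'.1 :=
                mul_le_mul_of_nonneg_left (by linarith) (by linarith)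
              intro hh; linarith
  obtain ⟨p, h0, h1, h2⟩ := key Finset.univ
  refine ⟨p, h0, h1, fun i j hij => ?_⟩
  by_contra hne
  exact h2 (i, j) (Finset.mem_univ _) hne hij

lemma count_lower {α β : Type*} [Fintype β] (C : Matrix α β ℤ) (h : IsPositiveMat C)
    (d : α → ℤ) (z0 : β → ℤ) (hz0 : C.mulVec z0 = d) (D : ℕ) (v : Fin D → β → ℤ)
    (hv : LinearIndependent ℤ v) (hv0 : ∀ k, C.mulVec (v k) = 0) :
    ∃ c : ℝ, 0 < c ∧ ∃ n₀ : ℕ, ∀ n ≥ n₀, c * (n : ℝ) ^ D ≤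
      (Nat.card {z : β → ℤ // C.mulVec z = d ∧ Function.Injective z ∧
        ∀ j, 1 ≤ z j ∧ z j ≤ (n : ℤ)} : ℝ) := by
  obtain ⟨p, hp0, hpp, hpi⟩ := exists_pos_inj C h
  have hVb : ∀ j, ∑ k, |v k j| ≤ ∑ j, ∑ k, |v k j| := fun j =>
    Finset.single_le_sum (f := fun j => ∑ k, |v k j|)
      (fun i _ => Finset.sum_nonneg fun k _ => abs_nonneg _) (Finset.mem_univ j)
  have hZb : ∀ j, |z0 j| ≤ ∑ j, |z0 j| := fun j =>
    Finset.single_le_sum (f := fun j => |z0 j|) (fun i _ => abs_nonneg _) (Finset.mem_univ j)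
  have hPb : ∀ j, p j ≤ ∑ j, p j := fun j =>
    Finset.single_le_sum (f := p) (fun i _ => (hpp i).le) (Finset.mem_univ j)
  have hV0 : 0 ≤ ∑ j, ∑ k, |v k j| :=
    Finset.sum_nonneg fun j _ => Finset.sum_nonneg fun k _ => abs_nonneg _
  have hZ0 : 0 ≤ ∑ j, |z0 j| := Finset.sum_nonneg fun j _ => abs_nonneg _
  have hP0 : 0 ≤ ∑ j, p j := Finset.sum_nonneg fun j _ => (hpp j).le
  generalize (∑ j, ∑ k, |v k j|) = V at *
  generalize (∑ j, |z0 j|) = Z at *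
  generalize (∑ j, p j) = P at *
  lift Z to ℕ using hZ0
  obtain ⟨W, hW⟩ : ∃ W : ℕ, (W : ℤ) = (2 * V + 3) * P + V + 1 :=
    ⟨((2 * V + 3) * P + V + 1).toNat, Int.toNat_of_nonneg (by positivity)⟩
  have hW1 : 0 < W := by
    have : (0:ℤ) < W := by rw [hW]; positivity
    exact_mod_cast this
  refine ⟨((W : ℝ)⁻¹) ^ D, by positivity, W * (Z + 1), fun n hn => ?_⟩
  set T := n / W with hT
  have hTZ : Z + 1 ≤ T := by
    rw [hT, Nat.le_div_iff_mul_le hW1, mul_comm]; exact hn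
  have hTn : T * W ≤ n := Nat.div_mul_le_self n W
  have hnT : n ≤ (T + 1) * W := by
    have := Nat.lt_div_mul_add (a := n) hW1
    rw [← hT] at this; nlinarith
  have hTZ' : (Z : ℤ) + 1 ≤ T := by exact_mod_cast hTZ
  have hTn' : (T : ℤ) * W ≤ n := by exact_mod_cast hTn
  set N : ℤ := T * (2 * V + 3) with hN
  let F : (Fin D → Fin (T + 1)) → β → ℤ := fun t =>
    z0 + N • p + ∑ k, ((t k : ℕ) : ℤ) • v k
  have hFe : ∀ t j, F t j = z0 j + N * p j + ∑ k, ((t k : ℕ) : ℤ) * v k j := by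
    intro t j; simp [F]
  have hsum : ∀ (t : Fin D → Fin (T + 1)) j, |∑ k, ((t k : ℕ) : ℤ) * v k j| ≤ T * V := by
    intro t j
    calc |∑ k, ((t k : ℕ) : ℤ) * v k j| ≤ ∑ k, |((t k : ℕ) : ℤ) * v k j| :=
          Finset.abs_sum_le_sum_abs _ _
      _ ≤ ∑ k, (T : ℤ) * |v k j| := by
          refine Finset.sum_le_sum fun k _ => ?_
          rw [abs_mul]
          refine mul_le_mul_of_nonneg_right ?_ (abs_nonneg _)
          rw [abs_of_nonneg (by positivity)]
          have := (t k).2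
          exact_mod_cast Nat.lt_succ_iff.1 this
      _ = T * ∑ k, |v k j| := by rw [Finset.mul_sum]
      _ ≤ T * V := mul_le_mul_of_nonneg_left (hVb j) (by positivity)
  have hN0 : 0 ≤ N := by positivity
  have hTV : 0 ≤ (T : ℤ) * V := by positivity
  have hNe : N = 2 * (T * V) + 3 * T := by rw [hN]; ring
  have hmem : ∀ t, C.mulVec (F t) = d ∧ Function.Injective (F t) ∧
      ∀ j, 1 ≤ F t j ∧ F t j ≤ (n : ℤ) := by
    intro t
    refine ⟨?_, ?_, ?_⟩
    · have : C.mulVec (∑ k, ((t k : ℕ) : ℤ) • v k) = 0 := by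
        rw [← Matrix.mulVecLin_apply, map_sum]
        refine Finset.sum_eq_zero fun k _ => ?_
        rw [map_smul, Matrix.mulVecLin_apply, hv0, smul_zero]
      simp only [F]
      rw [Matrix.mulVec_add, Matrix.mulVec_add, Matrix.mulVec_smul, hp0, hz0, this]
      simp
    · intro i j hij
      rw [hFe, hFe] at hij
      by_contra hne
      have h1 := abs_le.1 (hsum t i)
      have h2 := abs_le.1 (hsum t j)
      have h3 := abs_le.1 (hZb i)
      have h4 := abs_le.1 (hZb j)
      have hpne : p i ≠ p j := fun hh => hne (hpi hh)
      rcases lt_or_gt_of_ne hpne with h5 | h5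
      · have : N * (p i + 1) ≤ N * p j := mul_le_mul_of_nonneg_left (by linarith) hN0
        linarith
      · have : N * (p j + 1) ≤ N * p i := mul_le_mul_of_nonneg_left (by linarith) hN0
        linarith
    · intro j
      rw [hFe]
      have h1 := abs_le.1 (hsum t j)
      have h3 := abs_le.1 (hZb j)
      constructor
      · have : N * 1 ≤ N * p j := mul_le_mul_of_nonneg_left (hpp j) hN0
        linarith
      · have : N * p j ≤ N * P := mul_le_mul_of_nonneg_left (hPb j) hN0
        have h6 : (T : ℤ) * W = N * P + T * V + T := by rw [hW, hN]; ring
        linarith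
  have hFinj : Function.Injective F := by
    intro t t' htt
    have h1 : ∑ k, ((t k : ℕ) : ℤ) • v k = ∑ k, ((t' k : ℕ) : ℤ) • v k := by
      simpa [F] using htt
    have h2 : ∑ k, (((t k : ℕ) : ℤ) - ((t' k : ℕ) : ℤ)) • v k = 0 := by
      simp only [sub_smul, Finset.sum_sub_distrib, h1, sub_self]
    funext k
    have h3 := Fintype.linearIndependent_iff.1 hv _ h2 k
    apply Fin.ext
    omega
  have hfin : Finite {z : β → ℤ // C.mulVec z = d ∧ Function.Injective z ∧
        ∀ j, 1 ≤ z j ∧ z j ≤ (n : ℤ)} := by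
    have : (Set.pi Set.univ (fun _ : β => Set.Icc (1 : ℤ) n)).Finite :=
      Set.Finite.pi fun _ => Set.finite_Icc _ _
    refine Set.Finite.to_subtype (this.subset ?_)
    intro z hz
    exact fun j _ => hz.2.2 j
  have hcard : (T + 1) ^ D ≤ Nat.card {z : β → ℤ // C.mulVec z = d ∧ Function.Injective z ∧
        ∀ j, 1 ≤ z j ∧ z j ≤ (n : ℤ)} := by
    have := Nat.card_le_card_of_injective
      (fun t => (⟨F t, hmem t⟩ : {z : β → ℤ // C.mulVec z = d ∧ Function.Injective z ∧
        ∀ j, 1 ≤ z j ∧ z j ≤ (n : ℤ)}))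
      (fun a b hab => hFinj (congrArg Subtype.val hab))
    simpa using this
  calc ((W : ℝ)⁻¹) ^ D * (n : ℝ) ^ D = ((W : ℝ)⁻¹ * n) ^ D := (mul_pow _ _ _).symm
    _ ≤ ((T : ℝ) + 1) ^ D := by
        refine pow_le_pow_left₀ (by positivity) ?_ _
        rw [inv_mul_le_iff₀ (by exact_mod_cast hW1), mul_comm]
        exact_mod_cast hnT
    _ ≤ _ := by exact_mod_cast hcard

lemma rank_int_le {α β : Type*} [Fintype α] [Fintype β] (A : Matrix α β ℤ) :
    Module.finrank ℤ (LinearMap.range A.mulVecLin) ≤ rkZ A := by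
  let e := Module.finBasis ℤ (LinearMap.range A.mulVecLin)
  let ψ : (α → ℤ) →ₗ[ℤ] (α → ℚ) := (Algebra.linearMap ℤ ℚ).compLeft α
  have hψ : ∀ x i, ψ x i = (x i : ℚ) := fun x i => rfl
  have hψi : Function.Injective ψ := by
    intro x y hxy
    funext i
    have := congrFun hxy i
    rw [hψ, hψ] at this
    exact_mod_cast this
  have h1 : LinearIndependent ℤ (fun k => ψ (e k).1) :=
    (e.linearIndependent.map' (LinearMap.range A.mulVecLin).subtype (by simp)).map' ψ
      (LinearMap.ker_eq_bot.2 hψi)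
  have h2 : LinearIndependent ℚ (fun k => ψ (e k).1) :=
    (LinearIndependent.iff_fractionRing ℤ ℚ).1 h1
  have hm : ∀ k, ψ (e k).1 ∈ LinearMap.range (A.map (Int.cast : ℤ → ℚ)).mulVecLin := by
    intro k
    obtain ⟨x, hx⟩ := (e k).2
    refine ⟨fun j => (x j : ℚ), ?_⟩
    rw [← hx]
    funext i
    simp [hψ, Matrix.mulVec, dotProduct]
  have h3 : LinearIndependent ℚ (fun k => (⟨ψ (e k).1, hm k⟩ :
      LinearMap.range (A.map (Int.cast : ℤ → ℚ)).mulVecLin)) :=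
    LinearIndependent.of_comp (Submodule.subtype _) h2
  have := h3.fintype_card_le_finrank
  simpa [rkZ, Matrix.rank] using this

lemma finrank_ker_ge {α β : Type*} [Fintype α] [Fintype β] (A : Matrix α β ℤ) :
    Fintype.card β ≤ Module.finrank ℤ (LinearMap.ker A.mulVecLin) + rkZ A := by
  have h1 := rank_int_le A
  have h2 := Submodule.finrank_quotient_add_finrank (LinearMap.ker A.mulVecLin)
  rw [A.mulVecLin.quotKerEquivRange.finrank_eq] at h2
  rw [Module.finrank_fintype_fun_eq_card] at h2
  omega

/-- Extension by zero. -/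
def extZ {m : ℕ} (Q : Finset (Fin m)) : (Q → ℤ) →ₗ[ℤ] (Fin m → ℤ) where
  toFun d j := if h : j ∈ Q then d ⟨j, h⟩ else 0
  map_add' x y := by funext j; by_cases h : j ∈ Q <;> simp [h]
  map_smul' a x := by funext j; by_cases h : j ∈ Q <;> simp [h]

lemma extZ_apply {m : ℕ} (Q : Finset (Fin m)) (d : Q → ℤ) (j : Fin m) :
    extZ Q d j = if h : j ∈ Q then d ⟨j, h⟩ else 0 := rfl

lemma mulVec_extZ {r m : ℕ} (A : Matrix (Fin r) (Fin m) ℤ) (Q : Finset (Fin m)) (d : Q → ℤ) :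
    A.mulVec (extZ Q d) = (colSub A Q).mulVec d := by
  funext i
  simp only [Matrix.mulVec, dotProduct, colSub, Matrix.submatrix_apply, id]
  rw [← Finset.sum_subset (Finset.subset_univ Q), ← Finset.sum_coe_sort Q]
  · refine Finset.sum_congr rfl fun j _ => ?_
    simp [extZ_apply]
  · intro j _ hj
    simp [extZ_apply, hj]

/-- Glue two vectors into a vector indexed by columns of the compounded matrix. -/
def glue {m : ℕ} (P : Finset (Fin m)) (x y : Fin m → ℤ) :
    compIdx P (id : Fin m → Fin m) → ℤ :=
  Sum.elim (Sum.elim (fun j => x j.1) (fun j => x j.1)) (fun j => y j.1)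

lemma sum_split {m : ℕ} (P : Finset (Fin m)) (f : Fin m → ℤ) :
    ∑ j : {j // j ∉ P}, f j.1 + ∑ j : {j // j ∈ P}, f j.1 = ∑ j, f j := by
  rw [add_comm]
  convert Fintype.sum_subtype_add_sum_subtype (fun j => j ∈ P) f

lemma compMat_glue {r m : ℕ} (A : Matrix (Fin r) (Fin m) ℤ) (P : Finset (Fin m))
    (x y : Fin m → ℤ) (hxy : ∀ j ∈ P, x j = y j) :
    (compMat A A P (id : Fin m → Fin m)).mulVec (glue P x y) =
      Sum.elim (A.mulVec x) (A.mulVec y) := by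
  funext i
  rcases i with i | i
  · simp only [Matrix.mulVec, dotProduct, Fintype.sum_sum_type, compMat, glue, Sum.elim_inl,
      Sum.elim_inr, zero_mul, Finset.sum_const_zero, add_zero]
    exact sum_split P (fun j => A i j * x j)
  · simp only [Matrix.mulVec, dotProduct, Fintype.sum_sum_type, compMat, glue, Sum.elim_inl,
      Sum.elim_inr, zero_mul, Finset.sum_const_zero, zero_add, id]
    rw [← sum_split P (fun j => A i j * y j), add_comm]
    congr 1
    · have hP : P.image (id : Fin m → Fin m) = P := Finset.image_id
      refine Fintype.sum_equiv (Equiv.subtypeEquivRight (fun j => by rw [hP])) _ _ ?_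
      intro j; rfl
    · refine Finset.sum_congr rfl fun j _ => ?_
      rw [hxy j.1 j.2]

/-- **Lemma (lower bound for proper solutions of a compounded system).** -/
theorem compMat_proper_sols_lower_bound {r m : ℕ} (hr : 0 < r) (hrm : r < m)
    (A : Matrix (Fin r) (Fin m) ℤ) (hApos : IsPositiveMat A)
    (b : Fin r → ℤ) (hb : ∃ x : Fin m → ℤ, A.mulVec x = b)
    (Q : Finset (Fin m)) :
    ∃ Q' : Finset (Fin m), Q ⊆ Q' ∧ ∃ c : ℝ, 0 < c ∧ ∃ n₀ : ℕ, ∀ n ≥ n₀,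
      c * (n : ℝ) ^ (2 * m - rkZ A - rkZ (colSub A Qᶜ) - Q.card) ≤
        (Nat.card {z : compIdx Q' (id : Fin m → Fin m) → ℤ //
          (compMat A A Q' (id : Fin m → Fin m)).mulVec z = Sum.elim b b ∧
          Function.Injective z ∧ ∀ j, 1 ≤ z j ∧ z j ≤ (n : ℤ)} : ℝ) := by
  let K := LinearMap.ker A.mulVecLin
  let K' := LinearMap.ker (colSub A Qᶜ).mulVecLin
  let E := extZ (Qᶜ : Finset (Fin m))
  have hK : ∀ x : K, A.mulVec x.1 = 0 := fun x => x.2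
  have hE : ∀ d : K', A.mulVec (E d.1) = 0 := by
    intro d
    rw [mulVec_extZ]; exact d.2
  let Q' : Finset (Fin m) := Finset.univ.filter fun j => ∀ d : K', E d.1 j = 0
  have hQ' : ∀ j, j ∈ Q' ↔ ∀ d : K', E d.1 j = 0 := fun j => by simp [Q']
  have hQQ' : Q ⊆ Q' := by
    intro j hj
    rw [hQ']
    intro d
    simp [E, extZ_apply, hj]
  have him : ∀ j, j ∉ Q'.image (id : Fin m → Fin m) ↔ j ∉ Q' := by
    intro j; rw [Finset.image_id]
  refine ⟨Q', hQQ', ?_⟩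
  obtain ⟨x0, hx0⟩ := hb
  -- the parametrising linear map
  let Φ : (K × K') →ₗ[ℤ] (compIdx Q' (id : Fin m → Fin m) → ℤ) :=
    { toFun := fun q => glue Q' q.1.1 (q.1.1 + E q.2.1)
      map_add' := by
        rintro ⟨x, d⟩ ⟨y, e⟩
        funext j
        rcases j with (j | j) | j <;> simp [glue]
        ring
      map_smul' := by
        rintro a ⟨x, d⟩
        funext j
        rcases j with (j | j) | j
        · simp [glue]
        · simp [glue]
        · have hs : E (a • d.1) = a • E d.1 := map_smul E a d.1
          change (a • x.1 + E (a • d.1)) j.1 = a • ((x.1 + E d.1) j.1)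
          rw [hs]
          simp only [Pi.add_apply, Pi.smul_apply, smul_eq_mul]
          ring }
  have hΦ : ∀ q, Φ q = glue Q' q.1.1 (q.1.1 + E q.2.1) := fun q => rfl
  have hΦ0 : ∀ q, (compMat A A Q' (id : Fin m → Fin m)).mulVec (Φ q) = 0 := by
    intro q
    rw [hΦ, compMat_glue]
    · rw [Matrix.mulVec_add, hK, hE]
      funext i; rcases i with i | i <;> simp
    · intro j hj
      simp [(hQ' j).1 hj q.2]
  have hΦi : Function.Injective Φ := by
    rw [← LinearMap.ker_eq_bot, LinearMap.ker_eq_bot']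
    rintro ⟨x, d⟩ h
    rw [hΦ] at h
    have hx : ∀ j, x.1 j = 0 := by
      intro j
      by_cases hj : j ∈ Q'
      · exact congrFun h (Sum.inl (Sum.inr ⟨j, hj⟩))
      · exact congrFun h (Sum.inl (Sum.inl ⟨j, hj⟩))
    have hd : ∀ j, E d.1 j = 0 := by
      intro j
      by_cases hj : j ∈ Q'
      · exact (hQ' j).1 hj d
      · have := congrFun h (Sum.inr ⟨j, (him j).2 hj⟩)
        simpa [glue, hx] using this
    refine Prod.ext (Subtype.ext (funext hx)) (Subtype.ext (funext fun j => ?_))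
    have := hd j.1
    rw [extZ_apply, dif_pos j.2] at this
    exact this
  have hpos : IsPositiveMat (compMat A A Q' (id : Fin m → Fin m)) := by
    constructor
    · obtain ⟨p, hp, hpp⟩ := hApos.1
      refine ⟨Φ (⟨p, hp⟩, 0), hΦ0 _, ?_⟩
      rintro ((j | j) | j) <;> simp [hΦ, glue, hpp]
    · -- the common part: distinct underlying columns are separated diagonally
      have key : ∀ i j : Fin m, i ≠ j → ∃ q : K × K', q.2 = 0 ∧ q.1.1 i ≠ q.1.1 j := by
        intro i j hij
        obtain ⟨x, hx, hne⟩ := hApos.2 i j hij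
        exact ⟨(⟨x, hx⟩, 0), rfl, hne⟩
      have key2 : ∀ j : Fin m, j ∉ Q' → ∃ q : K × K', q.1 = 0 ∧ E q.2.1 j ≠ 0 := by
        intro j hj
        rw [hQ'] at hj
        push Not at hj
        obtain ⟨d, hd⟩ := hj
        exact ⟨(0, d), rfl, hd⟩
      intro i j hij
      suffices ∃ q, Φ q i ≠ Φ q j by
        obtain ⟨q, hq⟩ := this
        exact ⟨Φ q, hΦ0 q, hq⟩
      rcases i with (i | i) | i <;> rcases j with (j | j) | j
      · obtain ⟨q, h1, h2⟩ := key i.1 j.1 (fun h => hij (by simp [Subtype.ext_iff, h]))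
        exact ⟨q, by simpa [hΦ, glue, h1] using h2⟩
      · obtain ⟨q, h1, h2⟩ := key i.1 j.1 (fun h => i.2 (h ▸ j.2))
        exact ⟨q, by simpa [hΦ, glue, h1] using h2⟩
      · obtain ⟨q, h1, h2⟩ := key2 j.1 ((him _).1 j.2)
        exact ⟨q, by simpa [hΦ, glue, h1] using h2.symm⟩
      · obtain ⟨q, h1, h2⟩ := key i.1 j.1 (fun h => j.2 (h ▸ i.2))
        exact ⟨q, by simpa [hΦ, glue, h1] using h2⟩
      · obtain ⟨q, h1, h2⟩ := key i.1 j.1 (fun h => hij (by simp [Subtype.ext_iff, h]))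
        exact ⟨q, by simpa [hΦ, glue, h1] using h2⟩
      · obtain ⟨q, h1, h2⟩ := key2 j.1 ((him _).1 j.2)
        exact ⟨q, by simpa [hΦ, glue, h1] using h2.symm⟩
      · obtain ⟨q, h1, h2⟩ := key2 i.1 ((him _).1 i.2)
        exact ⟨q, by simpa [hΦ, glue, h1] using h2⟩
      · obtain ⟨q, h1, h2⟩ := key2 i.1 ((him _).1 i.2)
        exact ⟨q, by simpa [hΦ, glue, h1] using h2⟩
      · obtain ⟨q, h1, h2⟩ := key i.1 j.1 (fun h => hij (by simp [Subtype.ext_iff, h]))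
        exact ⟨q, by simpa [hΦ, glue, h1] using h2⟩
  let e := Module.finBasis ℤ (K × K')
  obtain ⟨c, hc, n₀, hn⟩ := count_lower (compMat A A Q' (id : Fin m → Fin m)) hpos
    (Sum.elim b b) (glue Q' x0 x0)
    (by rw [compMat_glue A Q' x0 x0 (fun _ _ => rfl), hx0])
    (Module.finrank ℤ (K × K')) (fun k => Φ (e k))
    (e.linearIndependent.map' Φ (LinearMap.ker_eq_bot.2 hΦi)) (fun k => hΦ0 _)
  refine ⟨c, hc, max n₀ 1, fun n hn' => ?_⟩
  refine le_trans ?_ (hn n (le_trans (le_max_left _ _) hn'))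
  refine mul_le_mul_of_nonneg_left ?_ hc.le
  have hn1 : 1 ≤ n := le_trans (le_max_right _ _) hn'
  refine pow_le_pow_right₀ (by exact_mod_cast hn1) ?_
  have h1 : Fintype.card (Fin m) ≤ Module.finrank ℤ K + rkZ A := finrank_ker_ge A
  have h2 : Fintype.card (Qᶜ : Finset (Fin m)) ≤ Module.finrank ℤ K' + rkZ (colSub A Qᶜ) :=
    finrank_ker_ge (colSub A Qᶜ)
  have h3 : Module.finrank ℤ (K × K') = Module.finrank ℤ K + Module.finrank ℤ K' :=
    Module.finrank_prod
  rw [Fintype.card_coe, Finset.card_compl] at h2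
  rw [Fintype.card_fin] at h1 h2
  rw [h3]
  omega
end
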